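/- Consider the threshold autoregressive model with exogenous covariates Y_t = (b_1(X_{t-1}) + a_1(X_{t-1})Y_{t-1})·1_{{Y_{t-1} ≤ r(X_{t-1})}} + (b_2(X_{t-1}) + a_2(X_{t-1})Y_{t-1})·1_{{Y_{t-1} > r(X_{t-1})}} + ε_t. Assume 𝔼|ε_0| < ∞, the distribution of ε_0 has a positive density f which is bounded below away from 0 on every compact subset of ℝ, 𝔼[log⁺|a_i(X_0)|] < ∞ and 𝔼[log⁺|b_i(X_0)|] < ∞ for i = 1,2, and 𝔼[log λ(X_0)] < 0 where λ(x) = max(|a_1(x)|, |a_2(x)|). Then there exists a unique stationary and ergodic solution ((Y_t, X_t))_{t∈ℤ} to these equations. -/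

import Mathlib

open MeasureTheory ProbabilityTheory Filter
open scoped ENNReal

noncomputable section

/-- The shift operator on two-sided paths. -/
def zshift {α : Type*} (x : ℤ → α) : ℤ → α := fun t => x (t + 1)

/-- The σ-algebra on the path space `(E × F)^ℤ` generated by the whole `F`-coordinate path
(environment) and the `E`-coordinates (chain) strictly before time `t`. -/
def histSigma (E F : Type*) [MeasurableSpace E] [MeasurableSpace F] (t : ℤ) :
    MeasurableSpace (ℤ → E × F) :=
  MeasurableSpace.comap
    (fun z => ((fun s => (z s).2, fun s : {s : ℤ // s < t} => (z s.1).1) :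
      (ℤ → F) × ({s : ℤ // s < t} → E))) inferInstance

/-- `μ` is the law of a process `((Y_t, X_t))_{t ∈ ℤ}` solving the Markov chain in random
environment model: `ℙ(Y_t ∈ A | X, Y_{t-1}, Y_{t-2}, …) = P_{X_{t-1}}(Y_{t-1}, A)` a.s. -/
def IsMCRESolution {E F : Type*} [MeasurableSpace E] [MeasurableSpace F]
    (P : Kernel (F × E) E) (μ : Measure (ℤ → E × F)) : Prop :=
  ∀ (t : ℤ) (A : Set E), MeasurableSet A →
    μ[({z : ℤ → E × F | (z t).1 ∈ A}).indicator (fun _ => (1 : ℝ)) | histSigma E F t]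
      =ᵐ[μ] fun z => (P ((z (t - 1)).2, (z (t - 1)).1) A).toReal

/-- The autoregression function of the threshold autoregressive model with exogenous
covariates. -/
def thresholdMap {d : ℕ} (a₁ a₂ b₁ b₂ r : (Fin d → ℝ) → ℝ) (x : Fin d → ℝ) (y : ℝ) : ℝ :=
  if y ≤ r x then b₁ x + a₁ x * y else b₂ x + a₂ x * y

section HelpersA
open scoped Topology NNReal

theorem exists_ultra_lim (v : ℕ → ℝ≥0∞) :
    ∃ c, Tendsto v (hyperfilter ℕ : Filter ℕ) (𝓝 c) := by
  obtain ⟨c, -, hc⟩ := isCompact_univ.ultrafilter_le_nhds ((hyperfilter ℕ).map v)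
    (by simp)
  exact ⟨c, hc⟩

theorem tendsto_inv_succ_ultra :
    Tendsto (fun n : ℕ => ((n : ℝ≥0∞) + 1)⁻¹) (hyperfilter ℕ : Filter ℕ) (𝓝 0) := by
  have h := ENNReal.tendsto_inv_nat_nhds_zero.comp (tendsto_add_atTop_nat 1)
  have h2 : Tendsto (fun n : ℕ => ((n : ℝ≥0∞) + 1)⁻¹) atTop (𝓝 0) := by
    refine h.congr fun n => ?_
    simp
  exact h2.mono_left Nat.hyperfilter_le_atTop

theorem exists_invariant_of_charge {S : Type*} [MeasurableSpace S] (K : Kernel S S)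
    [IsMarkovKernel K] (m : ℕ → Measure S) (hm : ∀ n, IsProbabilityMeasure (m n))
    (μ0 : Measure S)
    (hinv : ∀ n A, MeasurableSet A → (K ∘ₘ m n) A ≤ m n A + ((n : ℝ≥0∞) + 1)⁻¹)
    (hdom : ∀ ε : ℝ≥0∞, 0 < ε → ∃ N : ℝ≥0, ∀ n A, MeasurableSet A →
      m n A ≤ ((n : ℝ≥0∞) + 1)⁻¹ + N * μ0 A + ε)
    (T : ℕ → Set S) (hT : ∀ j, MeasurableSet (T j)) (hTmono : Monotone T)
    (hTun : ⋃ j, T j = Set.univ) (hTfin : ∀ j, μ0 (T j) ≠ ∞)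
    (hmass : ∃ j, ∃ δ : ℝ≥0∞, 0 < δ ∧ ∀ n, δ ≤ m n (T j)) :
    ∃ m' : Measure S, IsFiniteMeasure m' ∧ m' ≠ 0 ∧ K ∘ₘ m' = m' ∧
      ∀ A c, MeasurableSet A → (∀ n, m n A ≤ c) → m' A ≤ c := by
  choose M hM using fun A : Set S => exists_ultra_lim (fun n => m n A)
  have hMle : ∀ A c, (∀ n, m n A ≤ c) → M A ≤ c := fun A c h =>
    le_of_tendsto (hM A) (Eventually.of_forall h)
  have hMempty : M ∅ = 0 := by
    simpa using hMle ∅ 0 (by simp)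
  have hMadd : ∀ A B, MeasurableSet B → Disjoint A B → M (A ∪ B) = M A + M B := by
    intro A B hB hd
    refine tendsto_nhds_unique (hM (A ∪ B)) ?_
    refine ((hM A).add (hM B)).congr fun n => ?_
    rw [measure_union hd hB]
  have hMmono : ∀ A B, A ⊆ B → M A ≤ M B := by
    intro A B hAB
    exact le_of_tendsto_of_tendsto' (hM A) (hM B) (fun n => measure_mono hAB)
  have hMdom : ∀ ε : ℝ≥0∞, 0 < ε → ∃ N : ℝ≥0, ∀ A, MeasurableSet A →
      M A ≤ N * μ0 A + ε := by
    intro ε hε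
    obtain ⟨N, hN⟩ := hdom ε hε
    refine ⟨N, fun A hA => ?_⟩
    have h1 : Tendsto (fun n : ℕ => ((n : ℝ≥0∞) + 1)⁻¹ + (N * μ0 A + ε))
        (hyperfilter ℕ : Filter ℕ) (𝓝 (0 + (N * μ0 A + ε))) :=
      tendsto_inv_succ_ultra.add tendsto_const_nhds
    rw [zero_add] at h1
    refine le_of_tendsto_of_tendsto' (hM A) h1 fun n => ?_
    rw [← add_assoc]; exact hN n A hA
  have hMcont : ∀ A : ℕ → Set S, (∀ n, MeasurableSet (A n)) → Antitone A →
      ⋂ n, A n = ∅ → μ0 (A 0) ≠ ∞ → Tendsto (fun n => M (A n)) atTop (𝓝 0) := by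
    intro A hA hanti hempty hfin
    have hμ : Tendsto (fun n => μ0 (A n)) atTop (𝓝 0) := by
      have := tendsto_measure_iInter_atTop (μ := μ0) (s := A)
        (fun n => (hA n).nullMeasurableSet) hanti ⟨0, hfin⟩
      rwa [hempty, measure_empty] at this
    rw [ENNReal.tendsto_nhds_zero]
    intro ε hε
    have hε2 : 0 < ε / 2 := ENNReal.half_pos hε.ne'
    obtain ⟨N, hN⟩ := hMdom (ε / 2) hε2
    have h2 : Tendsto (fun n => (N : ℝ≥0∞) * μ0 (A n)) atTop (𝓝 0) := by
      have := ENNReal.Tendsto.const_mul (a := (N : ℝ≥0∞)) hμ (Or.inr ENNReal.coe_ne_top)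
      simpa using this
    filter_upwards [(ENNReal.tendsto_nhds_zero.1 h2) (ε / 2) hε2] with n hn
    calc M (A n) ≤ N * μ0 (A n) + ε / 2 := hN _ (hA n)
      _ ≤ ε / 2 + ε / 2 := by gcongr
      _ = ε := ENNReal.add_halves ε
  -- finite sums
  have hMsum : ∀ (f : ℕ → Set S), (∀ i, MeasurableSet (f i)) →
      Pairwise (Function.onFun Disjoint f) → ∀ n,
      M (⋃ i ∈ Finset.range n, f i) = ∑ i ∈ Finset.range n, M (f i) := by
    intro f hf hd n
    induction n with
    | zero => simp [hMempty]
    | succ k ih =>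
      rw [Finset.sum_range_succ, ← ih, Finset.range_add_one, Finset.set_biUnion_insert,
        Set.union_comm, hMadd _ _ (hf k)]
      rw [Set.disjoint_left]
      intro x hx hxk
      simp only [Set.mem_iUnion, Finset.mem_range] at hx
      obtain ⟨i, hi, hxi⟩ := hx
      exact Set.disjoint_left.1 (hd hi.ne) hxi hxk
  -- measures on annuli
  let D : ℕ → Set S := disjointed T
  have hDm : ∀ j, MeasurableSet (D j) := fun j => MeasurableSet.disjointed hT j
  have hDsub : ∀ j, D j ⊆ T j := fun j => disjointed_subset T j
  have hDdisj : Pairwise (Function.onFun Disjoint D) := disjoint_disjointed T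
  have hDfin : ∀ j, μ0 (D j) ≠ ∞ := fun j => ne_top_of_le_ne_top (hTfin j) (measure_mono (hDsub j))
  let mj : ℕ → Measure S := fun j => Measure.ofMeasurable (fun A _ => M (A ∩ D j))
    (by simp [hMempty]) (by
      intro f hf hd
      let B : ℕ → Set S := fun i => f i ∩ D j
      have hB : ∀ i, MeasurableSet (B i) := fun i => (hf i).inter (hDm j)
      have hBd : Pairwise (Function.onFun Disjoint B) := fun a b hab =>
        (hd hab).mono Set.inter_subset_left Set.inter_subset_left
      let R : ℕ → Set S := fun n => (⋃ i, B i) \ ⋃ i ∈ Finset.range n, B i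
      have hfinU : ∀ n, MeasurableSet (⋃ i ∈ Finset.range n, B i) := fun n =>
        Finset.measurableSet_biUnion _ (fun i _ => hB i)
      have hR : ∀ n, MeasurableSet (R n) := fun n => (MeasurableSet.iUnion hB).diff (hfinU n)
      have hRanti : Antitone R := by
        intro a b hab
        apply Set.sdiff_subset_sdiff_right
        apply Set.biUnion_subset_biUnion_left
        intro i hi
        simp at hi ⊢
        omega
      have hRempty : ⋂ n, R n = ∅ := by
        ext x
        simp only [Set.mem_iInter, Set.mem_empty_iff_false, iff_false, not_forall]
        by_cases hx : x ∈ ⋃ i, B i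
        · obtain ⟨i, hi⟩ := Set.mem_iUnion.1 hx
          refine ⟨i + 1, fun h => h.2 ?_⟩
          simp only [Set.mem_iUnion, Finset.mem_range]
          exact ⟨i, by omega, hi⟩
        · exact ⟨0, fun h => hx h.1⟩
      have hRfin : μ0 (R 0) ≠ ∞ := by
        refine ne_top_of_le_ne_top (hDfin j) (measure_mono ?_)
        intro x hx
        obtain ⟨i, hi⟩ := Set.mem_iUnion.1 hx.1
        exact hi.2
      have h0 := hMcont R hR hRanti hRempty hRfin
      have heq : ∀ n, M (⋃ i, B i) = ∑ i ∈ Finset.range n, M (B i) + M (R n) := by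
        intro n
        rw [← hMsum B hB hBd n, ← hMadd _ _ (hR n) Set.disjoint_sdiff_right]
        congr 1
        refine (Set.union_sdiff_cancel ?_).symm
        exact Set.iUnion₂_subset fun i _ => Set.subset_iUnion B i
      have ht := (ENNReal.tendsto_nat_tsum (fun i => M (B i))).add h0
      rw [add_zero] at ht
      have h3 : M (⋃ i, B i) = ∑' i, M (B i) :=
        tendsto_nhds_unique (tendsto_const_nhds.congr heq) ht
      rw [Set.iUnion_inter]
      exact h3)
  have hmj : ∀ j A, MeasurableSet A → mj j A = M (A ∩ D j) := fun j A hA =>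
    Measure.ofMeasurable_apply A hA
  let m' : Measure S := Measure.sum mj
  have hm' : ∀ A, MeasurableSet A → m' A = ∑' j, M (A ∩ D j) := fun A hA => by
    rw [Measure.sum_apply _ hA]
    exact tsum_congr fun j => hmj j A hA
  have hm'le : ∀ A, MeasurableSet A → m' A ≤ M A := by
    intro A hA
    rw [hm' A hA, ENNReal.tsum_eq_iSup_nat]
    refine iSup_le fun n => ?_
    rw [← hMsum (fun j => A ∩ D j) (fun j => hA.inter (hDm j))
      (fun a b hab => (hDdisj hab).mono Set.inter_subset_right Set.inter_subset_right) n]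
    exact hMmono _ _ (Set.iUnion₂_subset fun i _ => Set.inter_subset_left)
  have hm'ge : ∀ A j, MeasurableSet A → A ⊆ T j → M A ≤ m' A := by
    intro A j hA hAj
    rw [hm' A hA]
    refine le_trans ?_ (ENNReal.sum_le_tsum (Finset.range (j + 1)))
    rw [← hMsum (fun j => A ∩ D j) (fun j => hA.inter (hDm j))
      (fun a b hab => (hDdisj hab).mono Set.inter_subset_right Set.inter_subset_right) (j + 1)]
    apply hMmono
    intro x hx
    have h1 : x ∈ partialSups T j := by
      rw [hTmono.partialSups_eq]; exact hAj hx
    rw [← partialSups_disjointed, partialSups_eq_biUnion_range] at h1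
    simp only [Set.mem_iUnion, Finset.mem_range] at h1 ⊢
    obtain ⟨i, hi, hxi⟩ := h1
    exact ⟨i, hi, hx, hxi⟩
  have hMuniv : M Set.univ ≤ 1 := hMle _ _ (fun n => by simp)
  have hfin : IsFiniteMeasure m' :=
    ⟨lt_of_le_of_lt ((hm'le _ MeasurableSet.univ).trans hMuniv) ENNReal.one_lt_top⟩
  refine ⟨m', hfin, ?_, ?_, fun A c hA hc => (hm'le A hA).trans (hMle A c hc)⟩
  · obtain ⟨j, δ, hδ, h⟩ := hmass
    intro h0
    have h1 : δ ≤ M (T j) := ge_of_tendsto (hM (T j)) (Eventually.of_forall h)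
    have h2 := h1.trans (hm'ge (T j) j (hT j) le_rfl)
    rw [h0] at h2
    simp at h2
    exact hδ.ne' h2
  · -- lintegral comparison
    have hIntg : ∀ g : S → ℝ≥0∞, ∀ c, (∀ z, g z ≤ 1) → Tendsto (fun n => ∫⁻ z, g z ∂(m n))
        (hyperfilter ℕ : Filter ℕ) (𝓝 c) → ∫⁻ z, g z ∂m' ≤ c := by
      intro g c hg1 hc
      rw [lintegral]
      refine iSup₂_le fun φ hφ => ?_
      have h1 : Tendsto (fun n => φ.lintegral (m n)) (hyperfilter ℕ : Filter ℕ)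
          (𝓝 (∑ x ∈ φ.range, x * M (φ ⁻¹' {x}))) := by
        simp only [SimpleFunc.lintegral]
        refine tendsto_finsetSum _ fun x hx => ?_
        refine ENNReal.Tendsto.const_mul (hM _) ?_
        obtain ⟨z, rfl⟩ := SimpleFunc.mem_range.1 hx
        exact Or.inr (ne_top_of_le_ne_top ENNReal.one_ne_top ((hφ z).trans (hg1 z)))
      have h2 : φ.lintegral m' ≤ ∑ x ∈ φ.range, x * M (φ ⁻¹' {x}) := by
        rw [SimpleFunc.lintegral]
        refine Finset.sum_le_sum fun x _ => ?_
        gcongr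
        exact hm'le _ (φ.measurableSet_preimage _)
      refine h2.trans (le_of_tendsto_of_tendsto' h1 hc fun n => ?_)
      rw [← SimpleFunc.lintegral_eq_lintegral]
      exact lintegral_mono hφ
    have hle1 : ∀ A j, MeasurableSet A → A ⊆ T j → (K ∘ₘ m') A ≤ m' A := by
      intro A j hA hAj
      refine le_trans ?_ (hm'ge A j hA hAj)
      obtain ⟨c, hc⟩ := exists_ultra_lim (fun n => ∫⁻ z, K z A ∂(m n))
      rw [Measure.bind_apply hA K.aemeasurable]
      refine (hIntg _ c (fun z => prob_le_one) hc).trans ?_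
      have h1 := (hM A).add tendsto_inv_succ_ultra
      rw [add_zero] at h1
      refine le_of_tendsto_of_tendsto' hc h1 fun n => ?_
      have := hinv n A hA
      rwa [Measure.bind_apply hA K.aemeasurable] at this
    have hle : K ∘ₘ m' ≤ m' := by
      refine Measure.le_iff.2 fun A hA => ?_
      have hA1 : A = ⋃ j, A ∩ T j := by rw [← Set.inter_iUnion, hTun, Set.inter_univ]
      have hmo : Monotone fun j => A ∩ T j := fun a b hab =>
        Set.inter_subset_inter_right _ (hTmono hab)
      rw [hA1, hmo.measure_iUnion, hmo.measure_iUnion]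
      exact iSup_mono fun j => hle1 _ j (hA.inter (hT j)) Set.inter_subset_right
    refine Measure.eq_of_le_of_measure_univ_eq hle ?_
    rw [Measure.bind_apply MeasurableSet.univ K.aemeasurable]
    simp

end HelpersA

section HelpersB1
open scoped Topology NNReal

theorem drift_integral (ν : Measure ℝ) [IsProbabilityMeasure ν]
    (hν : Integrable (fun u : ℝ => |u|) ν) (s : ℝ) :
    ∫⁻ u, ENNReal.ofReal (Real.log (1 + |s + u|)) ∂ν ≤
      ENNReal.ofReal (Real.log (1 + |s| + ∫ u, |u| ∂ν)) := by
  set c := ∫ u, |u| ∂ν with hc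
  have hc0 : 0 ≤ c := integral_nonneg fun u => abs_nonneg u
  set a := 1 + |s| + c with ha
  have ha0 : 0 < a := by positivity
  have hpt : ∀ u : ℝ, Real.log (1 + |s + u|) ≤ (Real.log a - 1 + (1 + |s|) / a) + |u| / a := by
    intro u
    have h1 : 0 < 1 + |s + u| := by positivity
    have h2 := Real.log_le_sub_one_of_pos (div_pos h1 ha0)
    rw [Real.log_div h1.ne' ha0.ne'] at h2
    have h3 : (1 + |s + u|) / a ≤ (1 + |s|) / a + |u| / a := by
      rw [← add_div]
      refine div_le_div_of_nonneg_right ?_ ha0.le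
      linarith [abs_add_le s u]
    linarith
  have hIntg : Integrable (fun u : ℝ => (Real.log a - 1 + (1 + |s|) / a) + |u| / a) ν :=
    (integrable_const _).add (hν.div_const a)
  have hval : ∫ u, ((Real.log a - 1 + (1 + |s|) / a) + |u| / a) ∂ν = Real.log a := by
    rw [integral_add (integrable_const _) (hν.div_const a), integral_div, ← hc]
    simp only [integral_const, probReal_univ, smul_eq_mul, one_mul]
    have : (1 + |s|) / a + c / a = 1 := by
      rw [← add_div]; exact div_self ha0.ne'
    linarith
  calc ∫⁻ u, ENNReal.ofReal (Real.log (1 + |s + u|)) ∂ν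
      ≤ ∫⁻ u, ENNReal.ofReal ((Real.log a - 1 + (1 + |s|) / a) + |u| / a) ∂ν :=
        lintegral_mono fun u => ENNReal.ofReal_le_ofReal (hpt u)
    _ = ENNReal.ofReal (∫ u, ((Real.log a - 1 + (1 + |s|) / a) + |u| / a) ∂ν) := by
        rw [ofReal_integral_eq_lintegral_ofReal hIntg]
        refine Eventually.of_forall fun u => ?_
        exact le_trans (Real.log_nonneg (by linarith [abs_nonneg (s + u)])) (hpt u)
    _ = ENNReal.ofReal (Real.log a) := by rw [hval]

theorem select_radius {Ω : Type*} [MeasurableSpace Ω] (π : Measure Ω)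
    (l B : Ω → ℝ) (hl : Measurable l) (hB : Measurable B) (hl0 : ∀ x, 0 ≤ l x)
    (hB0 : ∀ x, 0 ≤ B x) (c : ℝ) (hc : 0 ≤ c)
    (hG : ∫⁻ x, ENNReal.ofReal (Real.log (1 + l x + B x + c)) ∂π < ∞)
    (hneg : ∫⁻ x, ENNReal.ofReal (Real.log (l x)) ∂π < ∫⁻ x, ENNReal.ofReal (-Real.log (l x)) ∂π) :
    ∃ n : ℕ, ∫⁻ x, ENNReal.ofReal (Real.log (l x + (1 + B x + c) / (1 + n))) ∂π <
      ∫⁻ x, ENNReal.ofReal (-Real.log (l x + (1 + B x + c) / (1 + n))) ∂π := by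
  have hw0 : ∀ x (n : ℕ), 0 < (1 + B x + c) / (1 + (n : ℝ)) := fun x n => by
    have := hB0 x
    positivity
  have htend : ∀ x, Tendsto (fun n : ℕ => l x + (1 + B x + c) / (1 + (n : ℝ))) atTop (𝓝 (l x)) := by
    intro x
    have h1 : Tendsto (fun n : ℕ => (1 + B x + c) / (1 + (n : ℝ))) atTop (𝓝 0) := by
      refine Tendsto.div_atTop tendsto_const_nhds ?_
      exact tendsto_atTop_add_const_left _ _ tendsto_natCast_atTop_atTop
    simpa using tendsto_const_nhds.add h1
  have hmeas : ∀ n : ℕ, Measurable fun x => Real.log (l x + (1 + B x + c) / (1 + (n : ℝ))) :=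
    fun n => by fun_prop
  have hlim1 : Tendsto (fun n : ℕ => ∫⁻ x, ENNReal.ofReal
      (Real.log (l x + (1 + B x + c) / (1 + (n : ℝ)))) ∂π) atTop
      (𝓝 (∫⁻ x, ENNReal.ofReal (Real.log (l x)) ∂π)) := by
    refine tendsto_lintegral_of_dominated_convergence
      (fun x => ENNReal.ofReal (Real.log (1 + l x + B x + c)))
      (fun n => (hmeas n).ennreal_ofReal) ?_ hG.ne ?_
    · intro n
      refine Eventually.of_forall fun x => ENNReal.ofReal_le_ofReal ?_
      refine Real.log_le_log (by linarith [hl0 x, hw0 x n]) ?_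
      have : (1 + B x + c) / (1 + (n : ℝ)) ≤ 1 + B x + c :=
        div_le_self (by linarith [hB0 x]) (by linarith [Nat.cast_nonneg (α := ℝ) n])
      linarith
    · refine Eventually.of_forall fun x => ?_
      rcases (hl0 x).eq_or_lt with h | h
      · have h0 : ENNReal.ofReal (Real.log (l x)) = 0 := by simp [← h]
        rw [h0]
        have hev : ∀ᶠ n : ℕ in atTop, l x + (1 + B x + c) / (1 + (n : ℝ)) < 1 :=
          (htend x).eventually (gt_mem_nhds (by rw [← h]; norm_num))
        refine tendsto_const_nhds.congr' ?_
        filter_upwards [hev] with n hn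
        refine (ENNReal.ofReal_of_nonpos (Real.log_nonpos ?_ hn.le)).symm
        linarith [hl0 x, hw0 x n]
      · exact ENNReal.tendsto_ofReal ((Real.continuousAt_log h.ne').tendsto.comp (htend x))
  have hlim2 : ∫⁻ x, ENNReal.ofReal (-Real.log (l x)) ∂π ≤ liminf (fun n : ℕ =>
      ∫⁻ x, ENNReal.ofReal (-Real.log (l x + (1 + B x + c) / (1 + (n : ℝ)))) ∂π) atTop := by
    refine le_trans ?_ (lintegral_liminf_le fun n => (hmeas n).neg.ennreal_ofReal)
    refine lintegral_mono fun x => ?_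
    rcases (hl0 x).eq_or_lt with h | h
    · simp [← h]
    · refine le_of_eq (Tendsto.liminf_eq ?_).symm
      exact ENNReal.tendsto_ofReal
        (((Real.continuousAt_log h.ne').tendsto.comp (htend x)).neg)
  obtain ⟨q, hq1, hq2⟩ := exists_between hneg
  have e1 := hlim1.eventually (gt_mem_nhds hq1)
  have e2 := eventually_lt_of_lt_liminf (lt_of_lt_of_le hq2 hlim2)
  obtain ⟨n, h1, h2⟩ := (e1.and e2).exists
  exact ⟨n, h1.trans h2⟩

end HelpersB1

section HelpersB2
open scoped Topology NNReal

theorem measurable_zshift {α : Type*} [MeasurableSpace α] :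
    Measurable (zshift : (ℤ → α) → ℤ → α) :=
  measurable_pi_lambda _ fun t => measurable_pi_apply (t + 1)

/-- One step of the chain together with the environment seen from the present. -/
def stepKernel {F : Type*} [MeasurableSpace F] (P : Kernel (F × ℝ) ℝ) :
    Kernel ((ℤ → F) × ℝ) ((ℤ → F) × ℝ) :=
  (Kernel.deterministic (fun p : (ℤ → F) × ℝ => zshift p.1)
    (measurable_zshift.comp measurable_fst)) ×ₖ
  (P.comap (fun p : (ℤ → F) × ℝ => (p.1 0, p.2))
    (((measurable_pi_apply 0).comp measurable_fst).prodMk measurable_snd))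

instance {F : Type*} [MeasurableSpace F] (P : Kernel (F × ℝ) ℝ) [IsMarkovKernel P] :
    IsMarkovKernel (stepKernel P) := by
  unfold stepKernel; infer_instance

theorem stepKernel_apply {F : Type*} [MeasurableSpace F] (P : Kernel (F × ℝ) ℝ)
    [IsMarkovKernel P] (p : (ℤ → F) × ℝ) :
    stepKernel P p = (P (p.1 0, p.2)).map (Prod.mk (zshift p.1)) := by
  unfold stepKernel
  rw [Kernel.prod_apply, Kernel.deterministic_apply, Kernel.comap_apply, Measure.dirac_prod]

theorem stepKernel_apply' {F : Type*} [MeasurableSpace F] (P : Kernel (F × ℝ) ℝ)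
    [IsMarkovKernel P] (p : (ℤ → F) × ℝ) {A : Set ((ℤ → F) × ℝ)} (hA : MeasurableSet A) :
    stepKernel P p A = P (p.1 0, p.2) (Prod.mk (zshift p.1) ⁻¹' A) := by
  rw [stepKernel_apply, Measure.map_apply measurable_prodMk_left hA]

theorem stepKernel_lintegral_snd {F : Type*} [MeasurableSpace F] (P : Kernel (F × ℝ) ℝ)
    [IsMarkovKernel P] (p : (ℤ → F) × ℝ) {g : ℝ → ℝ≥0∞} (hg : Measurable g) :
    ∫⁻ q, g q.2 ∂(stepKernel P p) = ∫⁻ u, g u ∂(P (p.1 0, p.2)) := by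
  rw [stepKernel_apply, lintegral_map (f := fun q : (ℤ → F) × ℝ => g q.2)
    (hg.comp measurable_snd) measurable_prodMk_left]

/-- The first marginal evolves by the shift. -/
theorem stepKernel_fst {F : Type*} [MeasurableSpace F] (P : Kernel (F × ℝ) ℝ)
    [IsMarkovKernel P] (m : Measure ((ℤ → F) × ℝ)) :
    (stepKernel P ∘ₘ m).map Prod.fst = (m.map Prod.fst).map zshift := by
  ext A hA
  rw [Measure.map_apply measurable_fst hA, Measure.bind_apply (measurable_fst hA)
    (stepKernel P).aemeasurable, Measure.map_apply measurable_zshift hA,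
    Measure.map_apply measurable_fst (measurable_zshift hA),
    ← lintegral_indicator_one (measurable_fst (measurable_zshift hA))]
  refine lintegral_congr fun p => ?_
  rw [stepKernel_apply' P p (measurable_fst hA)]
  by_cases h : zshift p.1 ∈ A
  · have : (Prod.mk (zshift p.1) ⁻¹' (Prod.fst ⁻¹' A) : Set ℝ) = Set.univ := by
      ext u; simp [h]
    rw [this]
    simp [Set.indicator, h]
  · have : (Prod.mk (zshift p.1) ⁻¹' (Prod.fst ⁻¹' A) : Set ℝ) = ∅ := by
      ext u; simp [h]
    rw [this]
    simp [Set.indicator, h]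

/-- pointwise drift inequality -/
theorem drift_pointwise (l B c y s : ℝ) (hl : 0 ≤ l) (hB : 0 ≤ B) (hc : 0 ≤ c) (n : ℕ)
    (hs : |s| ≤ l * |y| + B) :
    ENNReal.ofReal (Real.log (1 + |s| + c)) +
        ENNReal.ofReal (-Real.log (l + (1 + B + c) / (1 + n))) ≤
      ENNReal.ofReal (Real.log (1 + |y|)) + ENNReal.ofReal (Real.log (l + (1 + B + c) / (1 + n))) +
      (if |y| ≤ n then ENNReal.ofReal (Real.log (1 + l + B + c)) +
        ENNReal.ofReal (-Real.log (l + (1 + B + c) / (1 + n))) else 0) := by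
  have hy := abs_nonneg y
  have hs0 := abs_nonneg s
  set h := Real.log (l + (1 + B + c) / (1 + n)) with hh
  split_ifs with hyn
  · have h1 : Real.log (1 + |s| + c) ≤ Real.log (1 + |y|) + Real.log (1 + l + B + c) := by
      rw [← Real.log_mul (by positivity) (by positivity)]
      refine Real.log_le_log (by positivity) ?_
      nlinarith [mul_nonneg hy hB, mul_nonneg hy hc]
    have h2 : ENNReal.ofReal (Real.log (1 + |s| + c)) ≤ ENNReal.ofReal (Real.log (1 + |y|)) +
        ENNReal.ofReal (Real.log (1 + l + B + c)) :=
      (ENNReal.ofReal_le_ofReal h1).trans ENNReal.ofReal_add_le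
    calc _ ≤ ENNReal.ofReal (Real.log (1 + |y|)) +
        ENNReal.ofReal (Real.log (1 + l + B + c)) + ENNReal.ofReal (-h) := by gcongr
      _ ≤ _ := by
        rw [add_assoc (ENNReal.ofReal _) (ENNReal.ofReal _) (ENNReal.ofReal (-h))]
        exact add_le_add le_self_add le_rfl
  · push Not at hyn
    rw [add_zero]
    have hn : (0 : ℝ) ≤ n := Nat.cast_nonneg n
    have hw : 0 < (1 + B + c) / (1 + (n : ℝ)) := by positivity
    have h1 : Real.log (1 + |s| + c) ≤ Real.log (1 + |y|) + h := by
      rw [hh, ← Real.log_mul (by positivity) (by positivity)]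
      refine Real.log_le_log (by positivity) ?_
      have h3 : 1 + B + c ≤ (1 + |y|) * ((1 + B + c) / (1 + (n : ℝ))) := by
        rw [mul_div_assoc', le_div_iff₀ (by positivity), mul_comm]
        gcongr
      nlinarith
    have h0 : 0 ≤ Real.log (1 + |s| + c) := Real.log_nonneg (by linarith)
    have hV : 0 ≤ Real.log (1 + |y|) := Real.log_nonneg (by linarith)
    rcases le_total 0 h with hp | hp
    · rw [ENNReal.ofReal_of_nonpos (by linarith : -h ≤ 0), add_zero,
        ← ENNReal.ofReal_add hV hp]
      exact ENNReal.ofReal_le_ofReal h1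
    · rw [ENNReal.ofReal_of_nonpos hp, add_zero, ← ENNReal.ofReal_add h0 (by linarith)]
      exact ENNReal.ofReal_le_ofReal (by linarith)

end HelpersB2

section HelpersB3
open scoped Topology NNReal

theorem exists_tail_small {Ω : Type*} [MeasurableSpace Ω] (μ : Measure Ω) (g : Ω → ℝ≥0∞)
    (hg : Measurable g) (hfin : ∫⁻ x, g x ∂μ ≠ ∞) (hg' : ∀ x, g x ≠ ∞) (ε : ℝ≥0∞) (hε : 0 < ε) :
    ∃ N : ℕ, ∫⁻ x, (g x - N) ∂μ ≤ ε := by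
  have h : Tendsto (fun N : ℕ => ∫⁻ x, (g x - N) ∂μ) atTop (𝓝 (∫⁻ _, 0 ∂μ)) := by
    refine tendsto_lintegral_of_dominated_convergence g (fun n => hg.sub_const _)
      (fun n => Eventually.of_forall fun x => tsub_le_self) hfin (Eventually.of_forall fun x => ?_)
    obtain ⟨n, hn⟩ := ENNReal.exists_nat_gt (hg' x)
    refine tendsto_const_nhds.congr' ?_
    filter_upwards [eventually_ge_atTop n] with k hk
    refine (tsub_eq_zero_of_le (hn.le.trans ?_)).symm
    exact_mod_cast hk
  simp only [lintegral_zero] at h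
  exact ((ENNReal.tendsto_nhds_zero.1 h) ε hε).exists

/-- Forward laws of the chain. -/
def fwdLaw {S : Type*} [MeasurableSpace S] (K : Kernel S S) (η : Measure S) : ℕ → Measure S
  | 0 => η
  | k + 1 => K ∘ₘ fwdLaw K η k

theorem fwdLaw_prob {S : Type*} [MeasurableSpace S] (K : Kernel S S) [IsMarkovKernel K]
    (η : Measure S) [IsProbabilityMeasure η] (k : ℕ) : IsProbabilityMeasure (fwdLaw K η k) := by
  induction k with
  | zero => simpa [fwdLaw]
  | succ k ih => unfold fwdLaw; infer_instance

/-- Cesaro means of the forward laws. -/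
def cesaro {S : Type*} [MeasurableSpace S] (K : Kernel S S) (η : Measure S) (n : ℕ) : Measure S :=
  ((n : ℝ≥0∞) + 1)⁻¹ • ∑ k ∈ Finset.range (n + 1), fwdLaw K η k

theorem cesaro_apply {S : Type*} [MeasurableSpace S] (K : Kernel S S) (η : Measure S) (n : ℕ)
    (A : Set S) :
    cesaro K η n A = ((n : ℝ≥0∞) + 1)⁻¹ * ∑ k ∈ Finset.range (n + 1), fwdLaw K η k A := by
  simp [cesaro, Measure.finsetSum_apply]

theorem cesaro_lintegral {S : Type*} [MeasurableSpace S] (K : Kernel S S) (η : Measure S) (n : ℕ)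
    (g : S → ℝ≥0∞) :
    ∫⁻ z, g z ∂(cesaro K η n) =
      ((n : ℝ≥0∞) + 1)⁻¹ * ∑ k ∈ Finset.range (n + 1), ∫⁻ z, g z ∂(fwdLaw K η k) := by
  rw [cesaro, lintegral_smul_measure, lintegral_finsetSum_measure]
  rfl

theorem inv_succ_mul_succ (n : ℕ) : ((n : ℝ≥0∞) + 1)⁻¹ * ((n : ℝ≥0∞) + 1) = 1 :=
  ENNReal.inv_mul_cancel (by simp) (by finiteness)

theorem cesaro_prob {S : Type*} [MeasurableSpace S] (K : Kernel S S) [IsMarkovKernel K]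
    (η : Measure S) [IsProbabilityMeasure η] (n : ℕ) : IsProbabilityMeasure (cesaro K η n) := by
  constructor
  rw [cesaro_apply]
  have : ∀ k, fwdLaw K η k Set.univ = 1 := fun k => (fwdLaw_prob K η k).measure_univ
  simp only [this, Finset.sum_const, Finset.card_range, nsmul_eq_mul, mul_one]
  push_cast
  exact inv_succ_mul_succ n

theorem cesaro_inv {S : Type*} [MeasurableSpace S] (K : Kernel S S) [IsMarkovKernel K]
    (η : Measure S) [IsProbabilityMeasure η] (n : ℕ) (A : Set S) (hA : MeasurableSet A) :
    (K ∘ₘ cesaro K η n) A ≤ cesaro K η n A + ((n : ℝ≥0∞) + 1)⁻¹ := by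
  rw [Measure.bind_apply hA K.aemeasurable, cesaro_lintegral, cesaro_apply]
  have h1 : ∀ k, ∫⁻ z, K z A ∂(fwdLaw K η k) = fwdLaw K η (k + 1) A := fun k => by
    rw [fwdLaw, Measure.bind_apply hA K.aemeasurable]
  simp only [h1]
  calc _ ≤ ((n : ℝ≥0∞) + 1)⁻¹ * (∑ k ∈ Finset.range (n + 1), fwdLaw K η k A + 1) := by
        gcongr
        calc ∑ k ∈ Finset.range (n + 1), fwdLaw K η (k + 1) A
            ≤ ∑ k ∈ Finset.range (n + 1), fwdLaw K η (k + 1) A + fwdLaw K η 0 A := le_self_add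
          _ = ∑ k ∈ Finset.range (n + 1), fwdLaw K η k A + fwdLaw K η (n + 1) A := by
            exact (Finset.sum_range_succ' (fun k => fwdLaw K η k A) (n + 1)).symm.trans
              (Finset.sum_range_succ _ _)
          _ ≤ _ := by
            have := fwdLaw_prob K η (n + 1)
            gcongr
            exact prob_le_one
    _ = _ := by rw [mul_add, mul_one]

theorem exists_invariant_measure {F : Type*} [MeasurableSpace F] (π : Measure (ℤ → F))
    [IsProbabilityMeasure π] (hπ : Ergodic zshift π) (P : Kernel (F × ℝ) ℝ) [IsMarkovKernel P]
    (f : ℝ → ℝ) (hf : Measurable f) (ν : Measure ℝ) [IsProbabilityMeasure ν]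
    (hνf : ν = volume.withDensity fun u => ENNReal.ofReal (f u))
    (s : F × ℝ → ℝ) (hP : ∀ q, P q = ν.map fun u => s q + u)
    (l B : F → ℝ) (hl : Measurable l) (hB : Measurable B) (hl0 : ∀ x, 0 ≤ l x)
    (hB0 : ∀ x, 0 ≤ B x) (hs : ∀ x y, |s (x, y)| ≤ l x * |y| + B x)
    (hν : Integrable (fun u : ℝ => |u|) ν)
    (hG : ∫⁻ x, ENNReal.ofReal (Real.log (1 + l (x 0) + B (x 0) + ∫ u, |u| ∂ν)) ∂π < ∞)
    (hneg : ∫⁻ x, ENNReal.ofReal (Real.log (l (x 0))) ∂π <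
      ∫⁻ x, ENNReal.ofReal (-Real.log (l (x 0))) ∂π) :
    ∃ m : Measure ((ℤ → F) × ℝ), IsProbabilityMeasure m ∧ stepKernel P ∘ₘ m = m ∧
      m.map Prod.fst = π := by
  set c := ∫ u, |u| ∂ν with hc
  have hc0 : 0 ≤ c := integral_nonneg fun u => abs_nonneg u
  have hl' : Measurable fun x : ℤ → F => l (x 0) := hl.comp (measurable_pi_apply 0)
  have hB' : Measurable fun x : ℤ → F => B (x 0) := hB.comp (measurable_pi_apply 0)
  obtain ⟨R, hR⟩ := select_radius π (fun x => l (x 0)) (fun x => B (x 0)) hl' hB'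
    (fun x => hl0 _) (fun x => hB0 _) c hc0 hG hneg
  set K := stepKernel P with hK
  set η := fwdLaw K (π.prod (Measure.dirac (0 : ℝ))) with hη
  have hηp : ∀ k, IsProbabilityMeasure (η k) := fun k => fwdLaw_prob K _ k
  have hηfst : ∀ k, (η k).map Prod.fst = π := by
    intro k
    induction k with
    | zero => simp [hη, fwdLaw]
    | succ k ih =>
      rw [hη, fwdLaw, hK, stepKernel_fst, ← hK, ← hη, ih]
      exact hπ.toMeasurePreserving.map_eq
  have hηx : ∀ k (g : (ℤ → F) → ℝ≥0∞), Measurable g → ∫⁻ z, g z.1 ∂(η k) = ∫⁻ x, g x ∂π := by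
    intro k g hg
    rw [← hηfst k, lintegral_map hg measurable_fst]
  have hmx : ∀ n (g : (ℤ → F) → ℝ≥0∞), Measurable g →
      ∫⁻ z, g z.1 ∂(cesaro K (π.prod (Measure.dirac (0 : ℝ))) n) = ∫⁻ x, g x ∂π := by
    intro n g hg
    rw [cesaro_lintegral]
    simp only [← hη, hηx _ g hg, Finset.sum_const, Finset.card_range, nsmul_eq_mul]
    push_cast
    rw [← mul_assoc, inv_succ_mul_succ, one_mul]
  -- domination
  have hdom : ∀ ε : ℝ≥0∞, 0 < ε → ∃ N : ℝ≥0, ∀ n A, MeasurableSet A →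
      cesaro K (π.prod (Measure.dirac (0 : ℝ))) n A ≤
        ((n : ℝ≥0∞) + 1)⁻¹ + N * (π.prod volume) A + ε := by
    intro ε hε
    have h1 : ∫⁻ u, ENNReal.ofReal (f u) ≠ ∞ := by
      have h2 : ν Set.univ = 1 := measure_univ
      rw [hνf, withDensity_apply _ MeasurableSet.univ, Measure.restrict_univ] at h2
      rw [h2]; exact ENNReal.one_ne_top
    obtain ⟨N, hN⟩ := exists_tail_small volume (fun u => ENNReal.ofReal (f u))
      hf.ennreal_ofReal h1 (fun _ => ENNReal.ofReal_ne_top) ε hε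
    refine ⟨N, fun n A hA => ?_⟩
    have hνle : ∀ E, MeasurableSet E → ν E ≤ N * volume E + ε := by
      intro E hE
      rw [hνf, withDensity_apply _ hE]
      calc ∫⁻ u in E, ENNReal.ofReal (f u)
          ≤ ∫⁻ u in E, ((N : ℝ≥0∞) + (ENNReal.ofReal (f u) - N)) :=
            lintegral_mono fun u => le_add_tsub
        _ = N * volume E + ∫⁻ u in E, (ENNReal.ofReal (f u) - N) := by
            rw [lintegral_add_left measurable_const, setLIntegral_const]
        _ ≤ N * volume E + ε := by
            gcongr
            exact (setLIntegral_le_lintegral _ _).trans hN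
    have hPle : ∀ q E, MeasurableSet E → P q E ≤ N * volume E + ε := by
      intro q E hE
      rw [hP, Measure.map_apply (measurable_const_add _) hE]
      refine (hνle _ (measurable_const_add _ hE)).trans ?_
      rw [measure_preimage_add]
    have hstep : ∀ k, η (k + 1) A ≤ N * (π.prod volume) A + ε := by
      intro k
      have e1 : η (k + 1) = K ∘ₘ η k := by rw [hη, fwdLaw]
      rw [e1, Measure.bind_apply hA K.aemeasurable]
      have hmv : Measurable fun x : ℤ → F => (volume : Measure ℝ) (Prod.mk x ⁻¹' A) :=
        measurable_measure_prodMk_left hA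
      calc ∫⁻ z, K z A ∂(η k)
          ≤ ∫⁻ z, (N * volume (Prod.mk (zshift z.1) ⁻¹' A) + ε) ∂(η k) := by
            refine lintegral_mono fun z => ?_
            rw [hK, stepKernel_apply' P z hA]
            exact hPle _ _ (measurable_prodMk_left hA)
        _ = ∫⁻ x, (N * volume (Prod.mk (zshift x) ⁻¹' A) + ε) ∂π :=
            hηx k (fun x => N * volume (Prod.mk (zshift x) ⁻¹' A) + ε)
              (((hmv.comp measurable_zshift).const_mul _).add_const _)
        _ = ∫⁻ x, (N * volume (Prod.mk x ⁻¹' A) + ε) ∂π :=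
            hπ.toMeasurePreserving.lintegral_comp ((hmv.const_mul _).add_const _)
        _ = N * (π.prod volume) A + ε := by
            rw [lintegral_add_right _ measurable_const, lintegral_const_mul _ hmv,
              Measure.prod_apply hA]
            simp
    rw [cesaro_apply, ← hη, Finset.sum_range_succ']
    calc _ ≤ ((n : ℝ≥0∞) + 1)⁻¹ * (∑ k ∈ Finset.range n, (N * (π.prod volume) A + ε) + 1) := by
          have := hηp 0
          gcongr with k hk
          · exact hstep k
          · exact prob_le_one
      _ ≤ ((n : ℝ≥0∞) + 1)⁻¹ * (((n : ℝ≥0∞) + 1) * (N * (π.prod volume) A + ε) + 1) := by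
          gcongr
          rw [Finset.sum_const, Finset.card_range, nsmul_eq_mul]
          gcongr
          exact le_self_add
      _ = _ := by
          rw [mul_add, ← mul_assoc, inv_succ_mul_succ, one_mul, mul_one, add_comm, add_assoc]
          simp
  -- mass
  have hmass : ∃ j : ℕ, ∃ δ : ℝ≥0∞, 0 < δ ∧ ∀ n,
      δ ≤ cesaro K (π.prod (Measure.dirac (0 : ℝ))) n {p : (ℤ → F) × ℝ | |p.2| ≤ j} := by
    set h : (ℤ → F) → ℝ := fun x => Real.log (l (x 0) + (1 + B (x 0) + c) / (1 + R)) with hh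
    have hhm : Measurable h := by fun_prop
    have hhn : Measurable fun x => ENNReal.ofReal (-h x) := hhm.neg.ennreal_ofReal
    set G : (ℤ → F) → ℝ≥0∞ := fun x => ENNReal.ofReal (Real.log (1 + l (x 0) + B (x 0) + c))
      with hGdef
    have hGm : Measurable G := by fun_prop
    set q := ∫⁻ x, ENNReal.ofReal (-h x) ∂π with hq
    set p := ∫⁻ x, ENNReal.ofReal (h x) ∂π with hp
    have hpq : p < q := hR
    have hqb : ∀ x, ENNReal.ofReal (-h x) ≤ ENNReal.ofReal (Real.log (1 + R)) := by
      intro x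
      refine ENNReal.ofReal_le_ofReal ?_
      have hB0' := hB0 (x 0)
      have hl0' := hl0 (x 0)
      rw [hh, ← Real.log_inv]
      refine Real.log_le_log (by positivity) ?_
      rw [inv_le_comm₀ (by positivity) (by positivity), inv_eq_one_div]
      calc 1 / (1 + (R : ℝ)) ≤ (1 + B (x 0) + c) / (1 + R) := by gcongr; linarith
        _ ≤ _ := by linarith
    set W : (ℤ → F) → ℝ≥0∞ := fun x => G x + ENNReal.ofReal (-h x) with hW
    have hWm : Measurable W := hGm.add hhm.neg.ennreal_ofReal
    have hqfin : q ≠ ∞ := by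
      refine ne_top_of_le_ne_top ?_ (lintegral_mono hqb)
      simp
    have hWfin : ∫⁻ x, W x ∂π ≠ ∞ := by
      rw [hW, lintegral_add_left hGm]
      exact ENNReal.add_ne_top.2 ⟨hG.ne, hqfin⟩
    set V : ℝ → ℝ≥0∞ := fun y => ENNReal.ofReal (Real.log (1 + |y|)) with hV
    have hVm : Measurable V := by fun_prop
    set T : Set ((ℤ → F) × ℝ) := {p | |p.2| ≤ R} with hT
    have hTm : MeasurableSet T := measurableSet_le (by fun_prop) measurable_const
    -- one step drift
    have hdrift : ∀ z : (ℤ → F) × ℝ, ∫⁻ w, V w.2 ∂(K z) + ENNReal.ofReal (-h z.1) ≤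
        V z.2 + ENNReal.ofReal (h z.1) + T.indicator (fun z => W z.1) z := by
      intro z
      rw [hK, stepKernel_lintegral_snd P z hVm, hP, lintegral_map hVm (measurable_const_add _)]
      refine (add_le_add (drift_integral ν hν (s (z.1 0, z.2))) le_rfl).trans ?_
      have := drift_pointwise (l (z.1 0)) (B (z.1 0)) c z.2 (s (z.1 0, z.2)) (hl0 _) (hB0 _) hc0 R
        (hs _ _)
      exact this
    have hstep : ∀ k, ∫⁻ z, V z.2 ∂(η (k + 1)) + q ≤ ∫⁻ z, V z.2 ∂(η k) + p +
        ∫⁻ z, T.indicator (fun z => W z.1) z ∂(η k) := by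
      intro k
      have e1 : η (k + 1) = K ∘ₘ η k := by rw [hη, fwdLaw]
      have hVm2 : Measurable fun w : (ℤ → F) × ℝ => V w.2 := hVm.comp measurable_snd
      have hn2 : Measurable fun z : (ℤ → F) × ℝ => ENNReal.ofReal (-h z.1) :=
        hhn.comp measurable_fst
      have hVp : Measurable fun z : (ℤ → F) × ℝ => V z.2 + ENNReal.ofReal (h z.1) :=
        hVm2.add (hhm.ennreal_ofReal.comp measurable_fst)
      rw [e1, Measure.lintegral_bind K.aemeasurable hVm2.aemeasurable, hq, hp,
        ← hηx k _ hhn, ← hηx k _ hhm.ennreal_ofReal,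
        ← lintegral_add_right _ hn2, ← lintegral_add_left hVm2, ← lintegral_add_left hVp]
      exact lintegral_mono hdrift
    have hsum : ∀ k : ℕ, ∫⁻ z, V z.2 ∂(η k) + k * q ≤ k * p +
        ∑ i ∈ Finset.range k, ∫⁻ z, T.indicator (fun z => W z.1) z ∂(η i) := by
      intro k
      induction k with
      | zero =>
        have hVm2 : Measurable fun w : (ℤ → F) × ℝ => V w.2 := hVm.comp measurable_snd
        simp only [hη, fwdLaw]
        rw [lintegral_prod _ hVm2.aemeasurable]
        simp [hV]
      | succ k ih =>
        rw [Finset.sum_range_succ]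
        push_cast
        calc ∫⁻ z, V z.2 ∂(η (k + 1)) + (k + 1) * q
            = (∫⁻ z, V z.2 ∂(η (k + 1)) + q) + k * q := by ring
          _ ≤ (∫⁻ z, V z.2 ∂(η k) + p +
                ∫⁻ z, T.indicator (fun z => W z.1) z ∂(η k)) + k * q := by
              exact add_le_add (hstep k) le_rfl
          _ = (∫⁻ z, V z.2 ∂(η k) + k * q) + (p +
                ∫⁻ z, T.indicator (fun z => W z.1) z ∂(η k)) := by ring
          _ ≤ _ := add_le_add ih le_rfl
          _ = _ := by ring
    have hkey : ∀ n, q ≤ p + ∫⁻ z, T.indicator (fun z => W z.1) z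
        ∂(cesaro K (π.prod (Measure.dirac (0 : ℝ))) n) := by
      intro n
      rw [cesaro_lintegral, ← hη]
      have h1 := (le_add_self).trans (hsum (n + 1))
      push_cast at h1
      calc q = ((n : ℝ≥0∞) + 1)⁻¹ * (((n : ℝ≥0∞) + 1) * q) := by
            rw [← mul_assoc, inv_succ_mul_succ, one_mul]
        _ ≤ _ := mul_le_mul_right h1 _
        _ = _ := by rw [mul_add, ← mul_assoc, inv_succ_mul_succ, one_mul]
    have hδ : 0 < (q - p) / 2 := ENNReal.half_pos (tsub_pos_of_lt hpq).ne'
    obtain ⟨L, hL⟩ := exists_tail_small π W hWm hWfin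
      (fun x => ENNReal.add_ne_top.2 ⟨ENNReal.ofReal_ne_top, ENNReal.ofReal_ne_top⟩) _ hδ
    refine ⟨R, (q - p) / 2 / (L + 1), ENNReal.div_pos hδ.ne' (by finiteness), fun n => ?_⟩
    set m := cesaro K (π.prod (Measure.dirac (0 : ℝ))) n with hm
    have h1 : ∫⁻ z, T.indicator (fun z => W z.1) z ∂m ≤ L * m T + (q - p) / 2 := by
      calc ∫⁻ z, T.indicator (fun z => W z.1) z ∂m
          ≤ ∫⁻ z, (T.indicator (fun _ => (L : ℝ≥0∞)) z + (W z.1 - L)) ∂m := by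
            refine lintegral_mono fun z => ?_
            by_cases hz : z ∈ T
            · simp only [Set.indicator_of_mem hz]; exact le_add_tsub
            · simp [Set.indicator_of_notMem hz]
        _ = L * m T + ∫⁻ x, (W x - L) ∂π := by
            rw [lintegral_add_left (measurable_const.indicator hTm), lintegral_indicator_const hTm,
              ← hmx n _ (hWm.sub_const _)]
        _ ≤ _ := by gcongr
    have h2 : q - p ≤ L * m T + (q - p) / 2 := by
      refine (tsub_le_iff_left.2 (hkey n)).trans h1
    have hfin2 : (q - p) / 2 ≠ ∞ := by
      refine ENNReal.div_ne_top ?_ (by norm_num)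
      exact ne_top_of_le_ne_top hqfin tsub_le_self
    have h3 : (q - p) / 2 ≤ L * m T := by
      nth_rewrite 1 [← ENNReal.add_halves (q - p)] at h2
      exact (ENNReal.add_le_add_iff_right hfin2).1 h2
    refine ENNReal.div_le_of_le_mul ?_
    refine h3.trans ?_
    rw [mul_comm]
    gcongr
    exact le_self_add
  obtain ⟨m', hfin, hne, hinv, hle⟩ := exists_invariant_of_charge K
    (cesaro K (π.prod (Measure.dirac (0 : ℝ)))) (fun n => cesaro_prob K _ n) (π.prod volume)
    (fun n A hA => cesaro_inv K _ n A hA) hdom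
    (fun j : ℕ => {p : (ℤ → F) × ℝ | |p.2| ≤ j})
    (fun j => measurableSet_le (by fun_prop) measurable_const)
    (fun a b hab p hp => by
      have hp' : |p.2| ≤ (a : ℝ) := hp
      have hab' : (a : ℝ) ≤ b := by exact_mod_cast hab
      exact hp'.trans hab')
    (by
      ext p
      simp only [Set.mem_iUnion, Set.mem_ofPred_eq, Set.mem_univ, iff_true]
      exact exists_nat_ge _)
    (fun j => by
      have : {p : (ℤ → F) × ℝ | |p.2| ≤ j} = Set.univ ×ˢ Set.Icc (-(j : ℝ)) j := by
        ext p; simp [abs_le]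
      rw [this, Measure.prod_prod]
      simp) hmass
  have hρle : m'.map Prod.fst ≤ π := by
    refine Measure.le_iff.2 fun A hA => ?_
    rw [Measure.map_apply measurable_fst hA]
    refine hle _ _ (measurable_fst hA) fun n => ?_
    have := hmx n (A.indicator 1) (measurable_one.indicator hA)
    rw [lintegral_indicator_one hA] at this
    rw [← this, ← lintegral_indicator_one (measurable_fst hA)]
    rfl
  have hρinv : MeasurePreserving zshift (m'.map Prod.fst) (m'.map Prod.fst) :=
    ⟨measurable_zshift, by rw [← stepKernel_fst P, ← hK, hinv]⟩
  have hmf : IsFiniteMeasure (m'.map Prod.fst) := by infer_instance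
  obtain ⟨a, ha⟩ := hπ.eq_smul_of_absolutelyContinuous hρinv hρle.absolutelyContinuous
  have huniv : m' Set.univ = a := by
    have := congrArg (fun μ : Measure (ℤ → F) => μ Set.univ) ha
    simpa [Measure.map_apply measurable_fst MeasurableSet.univ] using this
  have ha0 : a ≠ 0 := by
    rw [← huniv]; simpa using hne
  have hatop : a ≠ ∞ := by rw [← huniv]; exact measure_ne_top _ _
  refine ⟨a⁻¹ • m', ⟨?_⟩, ?_, ?_⟩
  · simp [huniv, ENNReal.inv_mul_cancel ha0 hatop]
  · rw [Measure.comp_smul, hinv]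
  · rw [Measure.map_smul, ha, smul_smul, ENNReal.inv_mul_cancel ha0 hatop, one_smul]

end HelpersB3

section HelpersC
open scoped Topology NNReal

theorem comp_mono {S : Type*} [MeasurableSpace S] (K : Kernel S S) {μ ν : Measure S}
    (h : μ ≤ ν) : K ∘ₘ μ ≤ K ∘ₘ ν := by
  refine Measure.le_iff.2 fun A hA => ?_
  rw [Measure.bind_apply hA K.aemeasurable, Measure.bind_apply hA K.aemeasurable]
  exact lintegral_mono' h le_rfl

theorem comp_univ {S : Type*} [MeasurableSpace S] (K : Kernel S S) [IsMarkovKernel K]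
    (μ : Measure S) : (K ∘ₘ μ) Set.univ = μ Set.univ := by
  rw [Measure.bind_apply MeasurableSet.univ K.aemeasurable]
  simp

theorem invariant_unique {F : Type*} [MeasurableSpace F] (P : Kernel (F × ℝ) ℝ)
    [IsMarkovKernel P]
    (hPpos : ∀ q A, MeasurableSet A → (P q A = 0 ↔ (volume : Measure ℝ) A = 0))
    (m₁ m₂ : Measure ((ℤ → F) × ℝ)) [IsFiniteMeasure m₁] [IsFiniteMeasure m₂]
    (h₁ : stepKernel P ∘ₘ m₁ = m₁) (h₂ : stepKernel P ∘ₘ m₂ = m₂)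
    (hfst : m₁.map Prod.fst = m₂.map Prod.fst) : m₁ = m₂ := by
  set K := stepKernel P with hK
  set c := m₁ ⊓ m₂ with hc
  have hc1 : c ≤ m₁ := inf_le_left
  have hc2 : c ≤ m₂ := inf_le_right
  have hcf : IsFiniteMeasure c := isFiniteMeasure_of_le m₁ hc1
  have hKc : K ∘ₘ c = c := by
    refine Measure.eq_of_le_of_measure_univ_eq ?_ (comp_univ K c)
    exact le_inf ((comp_mono K hc1).trans h₁.le) ((comp_mono K hc2).trans h₂.le)
  have hadd1 : m₁ - c + c = m₁ := Measure.sub_add_cancel_of_le hc1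
  have hadd2 : m₂ - c + c = m₂ := Measure.sub_add_cancel_of_le hc2
  have hinv : ∀ m : Measure ((ℤ → F) × ℝ), IsFiniteMeasure m → K ∘ₘ m = m → m - c + c = m →
      K ∘ₘ (m - c) = m - c := by
    intro m hm hKm hmc
    have h1 : K ∘ₘ (m - c) + c = (m - c) + c := by
      nth_rewrite 2 [← hKc]
      rw [← Measure.comp_add, hmc, hKm]
    ext A hA
    have h2 := congrArg (fun μ : Measure ((ℤ → F) × ℝ) => μ A) h1
    simp only [Measure.add_apply] at h2
    exact (ENNReal.add_left_inj (measure_ne_top c A)).1 h2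
  have hi1 := hinv m₁ inferInstance h₁ hadd1
  have hi2 := hinv m₂ inferInstance h₂ hadd2
  have hfst' : (m₁ - c).map Prod.fst = (m₂ - c).map Prod.fst := by
    have h1 : (m₁ - c).map Prod.fst + c.map Prod.fst = (m₂ - c).map Prod.fst + c.map Prod.fst := by
      rw [← Measure.map_add _ _ measurable_fst, ← Measure.map_add _ _ measurable_fst, hadd1, hadd2,
        hfst]
    ext A hA
    have h2 := congrArg (fun μ : Measure (ℤ → F) => μ A) h1
    simp only [Measure.add_apply] at h2
    exact (ENNReal.add_left_inj (measure_ne_top _ A)).1 h2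
  have hsing : (m₁ - c) ⟂ₘ (m₂ - c) := by
    rw [Measure.mutuallySingular_iff_disjoint, disjoint_iff_inf_le]
    set ζ := (m₁ - c) ⊓ (m₂ - c) with hζ
    have h1 : ζ + c ≤ c := by
      refine le_inf ?_ ?_
      · calc ζ + c ≤ m₁ - c + c := by gcongr; exact inf_le_left
          _ = m₁ := hadd1
      · calc ζ + c ≤ m₂ - c + c := by gcongr; exact inf_le_right
          _ = m₂ := hadd2
    refine Measure.le_iff.2 fun A hA => ?_
    have h2 := Measure.le_iff.1 h1 A hA
    rw [Measure.add_apply] at h2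
    have h3 : ζ A + c A ≤ 0 + c A := by simpa using h2
    have h4 := (ENNReal.add_le_add_iff_right (measure_ne_top c A)).1 h3
    rw [nonpos_iff_eq_zero] at h4
    rw [h4]
    exact zero_le
  have hnull : ∀ m : Measure ((ℤ → F) × ℝ), K ∘ₘ m = m → ∀ A, MeasurableSet A →
      (m A = 0 ↔ ∀ᵐ x ∂(m.map Prod.fst), (volume : Measure ℝ) (Prod.mk (zshift x) ⁻¹' A) = 0) := by
    intro m hm A hA
    have hmv : Measurable fun x : ℤ → F => (volume : Measure ℝ) (Prod.mk (zshift x) ⁻¹' A) :=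
      (measurable_measure_prodMk_left hA).comp measurable_zshift
    nth_rewrite 1 [← hm]
    rw [Measure.bind_apply hA K.aemeasurable, lintegral_eq_zero_iff (K.measurable_coe hA),
      ae_map_iff (p := fun x => (volume : Measure ℝ) (Prod.mk (zshift x) ⁻¹' A) = 0)
        measurable_fst.aemeasurable (hmv (measurableSet_singleton 0))]
    refine eventually_congr (Eventually.of_forall fun p => ?_)
    show (stepKernel P) p A = 0 ↔ _
    rw [stepKernel_apply' P p hA, hPpos _ _ (measurable_prodMk_left hA)]
  have hac : (m₁ - c) ≪ (m₂ - c) := by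
    refine Measure.AbsolutelyContinuous.mk fun A hA h => ?_
    rw [hnull _ hi1 A hA, hfst', ← hnull _ hi2 A hA]
    exact h
  have hac' : (m₂ - c) ≪ (m₁ - c) := by
    refine Measure.AbsolutelyContinuous.mk fun A hA h => ?_
    rw [hnull _ hi2 A hA, ← hfst', ← hnull _ hi1 A hA]
    exact h
  have z1 := Measure.eq_zero_of_absolutelyContinuous_of_mutuallySingular hac hsing
  have z2 := Measure.eq_zero_of_absolutelyContinuous_of_mutuallySingular hac' hsing.symm
  rw [← hadd1, ← hadd2, z1, z2]

end HelpersC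

section HelpersD1
open scoped Topology NNReal

section PathSpace
set_option linter.unusedSectionVars false
variable {F : Type*} [MeasurableSpace F]

theorem comp_map_intertwine {S S' T T' : Type*} [MeasurableSpace S] [MeasurableSpace S']
    [MeasurableSpace T] [MeasurableSpace T'] (κ : Kernel S T) (κ' : Kernel S' T') (φ : T → T')
    (ψ : S → S') (hφ : Measurable φ) (hψ : Measurable ψ) (h : ∀ z, (κ z).map φ = κ' (ψ z))
    (ν : Measure S) : (κ ∘ₘ ν).map φ = κ' ∘ₘ (ν.map ψ) := by
  ext A hA
  rw [Measure.map_apply hφ hA, Measure.bind_apply (hφ hA) κ.aemeasurable,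
    Measure.bind_apply hA κ'.aemeasurable,
    lintegral_map (f := fun a => κ' a A) (κ'.measurable_coe hA) hψ]
  refine lintegral_congr fun z => ?_
  rw [← h, Measure.map_apply hφ hA]

/-- Keep the chain coordinates in `D`, set the others to `0`; keep the environment. -/
def keep (D : Set ℤ) (z : ℤ → ℝ × F) : ℤ → ℝ × F :=
  fun s => (D.indicator (fun s => (z s).1) s, (z s).2)

theorem measurable_keep (D : Set ℤ) : Measurable (keep D : (ℤ → ℝ × F) → ℤ → ℝ × F) := by
  refine measurable_pi_lambda _ fun s => ?_
  by_cases h : s ∈ D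
  · simp only [keep, Set.indicator_of_mem h]
    exact (measurable_pi_apply s)
  · simp only [keep, Set.indicator_of_notMem h]
    exact measurable_const.prodMk (measurable_snd.comp (measurable_pi_apply s))

theorem keep_keep (D D' : Set ℤ) (z : ℤ → ℝ × F) : keep D (keep D' z) = keep (D ∩ D') z := by
  funext s
  simp only [keep]
  by_cases h : s ∈ D <;> by_cases h' : s ∈ D' <;> simp [h, h']

theorem keep_comp_keep (D D' : Set ℤ) :
    (keep D : (ℤ → ℝ × F) → _) ∘ keep D' = keep (D ∩ D') := by
  funext z; exact keep_keep D D' z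

theorem map_keep_keep (D D' : Set ℤ) (μ : Measure (ℤ → ℝ × F)) :
    (μ.map (keep D')).map (keep D) = μ.map (keep (D ∩ D')) := by
  rw [Measure.map_map (measurable_keep D) (measurable_keep D'), keep_comp_keep]

theorem keep_snd (D : Set ℤ) (z : ℤ → ℝ × F) (s : ℤ) : (keep D z s).2 = (z s).2 := rfl

theorem keep_of_mem {D : Set ℤ} (z : ℤ → ℝ × F) {s : ℤ} (h : s ∈ D) : keep D z s = z s := by
  simp [keep, h]

theorem keep_fst_of_notMem {D : Set ℤ} (z : ℤ → ℝ × F) {s : ℤ} (h : s ∉ D) :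
    (keep D z s).1 = 0 := by
  simp [keep, h]

/-- Replace the chain coordinate at `t`. -/
def setY (t : ℤ) (p : (ℤ → ℝ × F) × ℝ) : ℤ → ℝ × F :=
  Function.update p.1 t (p.2, (p.1 t).2)

theorem measurable_setY (t : ℤ) : Measurable (setY t : (ℤ → ℝ × F) × ℝ → _) := by
  refine measurable_pi_lambda _ fun s => ?_
  by_cases h : s = t
  · subst h
    simp only [setY, Function.update_self]
    exact measurable_snd.prodMk
      (measurable_snd.comp ((measurable_pi_apply s).comp measurable_fst))
  · simp only [setY, Function.update_of_ne h]
    exact (measurable_pi_apply s).comp measurable_fst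

/-- The pair which determines the law of the chain at time `t`. -/
def prevQ (t : ℤ) (z : ℤ → ℝ × F) : F × ℝ := ((z (t - 1)).2, (z (t - 1)).1)

theorem measurable_prevQ (t : ℤ) : Measurable (prevQ t : (ℤ → ℝ × F) → _) :=
  (measurable_snd.comp (measurable_pi_apply _)).prodMk
    (measurable_fst.comp (measurable_pi_apply _))

/-- kernel giving the conditional law of `Y_t`. -/
def condY (P : Kernel (F × ℝ) ℝ) (t : ℤ) : Kernel (ℤ → ℝ × F) ℝ :=
  P.comap (prevQ t) (measurable_prevQ t)

instance (P : Kernel (F × ℝ) ℝ) [IsMarkovKernel P] (t : ℤ) : IsMarkovKernel (condY P t) := by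
  unfold condY; infer_instance

/-- Resample the chain coordinate at time `t`. -/
def resample (P : Kernel (F × ℝ) ℝ) (t : ℤ) : Kernel (ℤ → ℝ × F) (ℤ → ℝ × F) :=
  (Kernel.id ×ₖ condY P t).map (setY t)

instance (P : Kernel (F × ℝ) ℝ) [IsMarkovKernel P] (t : ℤ) : IsMarkovKernel (resample P t) := by
  unfold resample
  exact Kernel.IsMarkovKernel.map _ (measurable_setY t)

variable (P : Kernel (F × ℝ) ℝ) [IsMarkovKernel P]

theorem measurable_setY_mk (t : ℤ) (z : ℤ → ℝ × F) : Measurable fun u => setY t (z, u) :=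
  (measurable_setY t).comp measurable_prodMk_left

theorem resample_apply (t : ℤ) (z : ℤ → ℝ × F) :
    resample P t z = (P (prevQ t z)).map fun u => setY t (z, u) := by
  unfold resample
  rw [Kernel.map_apply _ (measurable_setY t), Kernel.prod_apply, Kernel.id_apply, condY,
    Kernel.comap_apply, Measure.dirac_prod, Measure.map_map (measurable_setY t)
    measurable_prodMk_left]
  rfl

theorem resample_comp (t : ℤ) (ν : Measure (ℤ → ℝ × F)) [SFinite ν] :
    resample P t ∘ₘ ν = (ν ⊗ₘ condY P t).map (setY t) := by
  unfold resample
  rw [Measure.compProd_eq_comp_prod, Measure.map_comp _ _ (measurable_setY t)]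

theorem resample_map {T : Type*} [MeasurableSpace T] {φ : (ℤ → ℝ × F) → T} (hφ : Measurable φ)
    (t : ℤ) (z : ℤ → ℝ × F) :
    (resample P t z).map φ = (P (prevQ t z)).map fun u => φ (setY t (z, u)) := by
  rw [resample_apply, Measure.map_map hφ (measurable_setY_mk t z)]
  rfl

theorem resample_keep (t : ℤ) {D : Set ℤ} (ht : t ∈ D) (ht' : t - 1 ∈ D)
    (ν : Measure (ℤ → ℝ × F)) :
    (resample P t ∘ₘ ν).map (keep D) = resample P t ∘ₘ (ν.map (keep D)) := by
  refine comp_map_intertwine _ _ _ _ (measurable_keep D) (measurable_keep D) (fun z => ?_) ν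
  rw [resample_map P (measurable_keep D), resample_apply]
  have h1 : prevQ t (keep D z) = prevQ t z := by simp [prevQ, keep_of_mem z ht']
  rw [h1]
  congr 1
  funext u s
  by_cases h : s = t
  · subst h; simp [keep, setY, ht]
  · simp [keep, setY, h, Set.indicator]

theorem resample_keep' (t : ℤ) {D : Set ℤ} (ht : t ∉ D) (ν : Measure (ℤ → ℝ × F)) :
    (resample P t ∘ₘ ν).map (keep D) = ν.map (keep D) := by
  have := comp_map_intertwine (resample P t) Kernel.id (keep D) (keep D) (measurable_keep D)
    (measurable_keep D) (fun z => ?_) ν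
  · rw [this, Measure.id_comp]
  · rw [resample_map P (measurable_keep D), Kernel.id_apply]
    have : (fun u => keep D (setY t (z, u))) = fun _ => keep D z := by
      funext u s
      by_cases h : s = t
      · subst h; simp [keep, setY, ht]
      · simp [keep, setY, h, Set.indicator]
    rw [this]
    simp

theorem resample_zshift (t : ℤ) (ν : Measure (ℤ → ℝ × F)) :
    (resample P (t + 1) ∘ₘ ν).map zshift = resample P t ∘ₘ (ν.map zshift) := by
  refine comp_map_intertwine _ _ _ _ measurable_zshift measurable_zshift (fun z => ?_) ν
  rw [resample_map P measurable_zshift, resample_apply]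
  have h1 : prevQ t (zshift z) = prevQ (t + 1) z := by simp [prevQ, zshift]
  rw [h1]
  congr 1
  funext u s
  by_cases h : s = t
  · subst h; simp [zshift, setY]
  · simp [zshift, setY, h]

/-- environment seen from time `a` and the chain at time `a`. -/
def stateAt (a : ℤ) (z : ℤ → ℝ × F) : (ℤ → F) × ℝ := (fun s => (z (s + a)).2, (z a).1)

theorem measurable_stateAt (a : ℤ) : Measurable (stateAt a : (ℤ → ℝ × F) → _) :=
  (measurable_pi_lambda _ fun s => measurable_snd.comp (measurable_pi_apply _)).prodMk
    (measurable_fst.comp (measurable_pi_apply _))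

/-- path with the chain put at time `a`. -/
def embedAt (a : ℤ) (p : (ℤ → F) × ℝ) : ℤ → ℝ × F :=
  fun s => (if s = a then p.2 else 0, p.1 (s - a))

theorem measurable_embedAt (a : ℤ) : Measurable (embedAt a : (ℤ → F) × ℝ → _) := by
  refine measurable_pi_lambda _ fun s => ?_
  refine Measurable.prodMk ?_ ((measurable_pi_apply (s - a)).comp measurable_fst)
  by_cases h : s = a
  · simp only [h, if_true]; exact measurable_snd
  · simp only [h, if_false]; exact measurable_const

theorem embedAt_stateAt (a : ℤ) (z : ℤ → ℝ × F) : embedAt a (stateAt a z) = keep {a} z := by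
  funext s
  by_cases h : s = a
  · subst h; simp [embedAt, stateAt, keep]
  · simp [embedAt, stateAt, keep, h]

theorem stateAt_embedAt (a : ℤ) (p : (ℤ → F) × ℝ) : stateAt a (embedAt a p) = p := by
  simp [embedAt, stateAt]

theorem stateAt_zshift (a : ℤ) (z : ℤ → ℝ × F) : stateAt a (zshift z) = stateAt (a + 1) z := by
  simp [stateAt, zshift, add_assoc]

theorem zshift_embedAt (a : ℤ) (p : (ℤ → F) × ℝ) : zshift (embedAt (a + 1) p) = embedAt a p := by
  funext s; simp [embedAt, zshift]

theorem stateAt_keep (a : ℤ) {D : Set ℤ} (h : a ∈ D) (z : ℤ → ℝ × F) :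
    stateAt a (keep D z) = stateAt a z := by
  simp [stateAt, keep, h]

theorem resample_stateAt (t : ℤ) (ν : Measure (ℤ → ℝ × F)) :
    (resample P t ∘ₘ ν).map (stateAt t) = stepKernel P ∘ₘ (ν.map (stateAt (t - 1))) := by
  refine comp_map_intertwine _ _ _ _ (measurable_stateAt t) (measurable_stateAt (t - 1))
    (fun z => ?_) ν
  rw [resample_map P (measurable_stateAt t), stepKernel_apply]
  have h1 : ((stateAt (t - 1) z).1 0, (stateAt (t - 1) z).2) = prevQ t z := by
    simp [prevQ, stateAt]
  rw [h1]
  congr 1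
  funext u
  refine Prod.ext ?_ ?_
  · funext s
    by_cases h : s = 0
    · subst h; simp [stateAt, setY, zshift]
    · have : s + t ≠ t := by omega
      have h2 : s + 1 + (t - 1) = s + t := by ring
      simp [stateAt, setY, zshift, this, h2, h]
  · simp [stateAt, setY]

theorem zshift_keep (a b : ℤ) (z : ℤ → ℝ × F) :
    keep (Set.Icc a b) (zshift z) = zshift (keep (Set.Icc (a + 1) (b + 1)) z) := by
  funext s
  have h : s + 1 ∈ Set.Icc (a + 1) (b + 1) ↔ s ∈ Set.Icc a b := by
    simp only [Set.mem_Icc]; omega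
  by_cases hs : s ∈ Set.Icc a b
  · simp only [keep, zshift, Set.indicator_of_mem hs, Set.indicator_of_mem (h.2 hs)]
  · simp only [keep, zshift, Set.indicator_of_notMem hs,
      Set.indicator_of_notMem (fun h' => hs (h.1 h'))]

theorem ext_of_window {μ ν : Measure (ℤ → ℝ × F)} [IsFiniteMeasure μ] [IsFiniteMeasure ν] (n₀ : ℕ)
    (h : ∀ n : ℕ, n₀ ≤ n → μ.map (keep (Set.Icc (-(n : ℤ)) n)) = ν.map (keep (Set.Icc (-(n : ℤ)) n))) :
    μ = ν := by
  have key : ∀ I : Finset ℤ, μ.map I.restrict = ν.map I.restrict := by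
    intro I
    set n := max n₀ (I.sup Int.natAbs) with hn
    have hI : ∀ s ∈ I, s ∈ Set.Icc (-(n : ℤ)) n := by
      intro s hs
      have : s.natAbs ≤ n := (Finset.le_sup (f := Int.natAbs) hs).trans (le_max_right _ _)
      rw [Set.mem_Icc]; omega
    have hr : (I.restrict : (ℤ → ℝ × F) → _) = I.restrict ∘ keep (Set.Icc (-(n : ℤ)) n) := by
      funext z s
      exact (keep_of_mem z (hI s s.2)).symm
    have hm : Measurable (I.restrict : (ℤ → ℝ × F) → _) := Finset.measurable_restrict I
    rw [hr, ← Measure.map_map hm (measurable_keep _), ← Measure.map_map hm (measurable_keep _),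
      h n (le_max_left _ _)]
  have hν : IsProjectiveLimit ν (fun I : Finset ℤ => ν.map I.restrict) := fun I => rfl
  have hμ : IsProjectiveLimit μ (fun I : Finset ℤ => ν.map I.restrict) := key
  exact hμ.unique hν

end PathSpace

end HelpersD1

section HelpersD2
open scoped Topology NNReal

section PathSpace2
set_option linter.unusedSectionVars false
variable {F : Type*} [MeasurableSpace F]
variable (P : Kernel (F × ℝ) ℝ) [IsMarkovKernel P]

/-- law of a window -/
def winLaw (m : Measure ((ℤ → F) × ℝ)) (a : ℤ) : ℕ → Measure (ℤ → ℝ × F)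
  | 0 => m.map (embedAt a)
  | n + 1 => resample P (a + n + 1) ∘ₘ winLaw m a n

variable (m : Measure ((ℤ → F) × ℝ)) 

instance winLaw_prob [IsProbabilityMeasure m] (a : ℤ) (n : ℕ) :
    IsProbabilityMeasure (winLaw P m a n) := by
  induction n with
  | zero => exact Measure.isProbabilityMeasure_map (measurable_embedAt a).aemeasurable
  | succ n ih => rw [winLaw]; infer_instance

theorem winLaw_self (a : ℤ) (n : ℕ) :
    (winLaw P m a n).map (keep (Set.Icc a (a + n))) = winLaw P m a n := by
  induction n with
  | zero =>
    rw [winLaw, Measure.map_map (measurable_keep _) (measurable_embedAt a)]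
    congr 1
    funext p
    rw [Function.comp_apply]
    simp only [Nat.cast_zero, add_zero, Set.Icc_self]
    rw [← embedAt_stateAt, stateAt_embedAt]
  | succ n ih =>
    rw [winLaw, resample_keep P _ (by simp only [Set.mem_Icc]; push_cast; omega)
      (by simp only [Set.mem_Icc]; push_cast; omega)]
    congr 1
    rw [← ih, map_keep_keep]
    congr 2
    ext s; simp only [Set.mem_inter_iff, Set.mem_Icc]; push_cast; omega

theorem winLaw_keep (a : ℤ) (n : ℕ) (D : Set ℤ) :
    (winLaw P m a n).map (keep D) = (winLaw P m a n).map (keep (D ∩ Set.Icc a (a + n))) := by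
  rw [← map_keep_keep, winLaw_self]

theorem winLaw_right (a : ℤ) (k l : ℕ) :
    (winLaw P m a (k + l)).map (keep (Set.Icc a (a + k))) = winLaw P m a k := by
  induction l with
  | zero => exact winLaw_self P m a k
  | succ l ih =>
    rw [← add_assoc, winLaw, resample_keep' P _ (by simp only [Set.mem_Icc]; push_cast; omega), ih]

theorem winLaw_left1 (hm : stepKernel P ∘ₘ m = m) (a : ℤ) (n : ℕ) :
    (winLaw P m a (n + 1)).map (keep (Set.Icc (a + 1) (a + 1 + n))) = winLaw P m (a + 1) n := by
  induction n with
  | zero =>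
    have h1 : (keep (Set.Icc (a + 1) (a + 1 + ((0 : ℕ) : ℤ))) : (ℤ → ℝ × F) → _) =
        embedAt (a + 1) ∘ stateAt (a + 1) := by
      funext z
      rw [Function.comp_apply, embedAt_stateAt]
      simp
    rw [h1, ← Measure.map_map (measurable_embedAt _) (measurable_stateAt _), winLaw, winLaw, winLaw]
    congr 1
    have h2 : a + ((0 : ℕ) : ℤ) + 1 = a + 1 := by simp
    rw [h2, resample_stateAt, add_sub_cancel_right,
      Measure.map_map (measurable_stateAt _) (measurable_embedAt _)]
    have h3 : (stateAt a ∘ embedAt a : (ℤ → F) × ℝ → _) = id := by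
      funext p; exact stateAt_embedAt a p
    rw [h3, Measure.map_id, hm]
  | succ n ih =>
    rw [winLaw, resample_keep P _ (by simp only [Set.mem_Icc]; push_cast; omega)
      (by simp only [Set.mem_Icc]; push_cast; omega), winLaw_keep]
    rw [show winLaw P m (a + 1) (n + 1) = resample P (a + 1 + n + 1) ∘ₘ winLaw P m (a + 1) n from rfl,
      ← ih]
    have e1 : a + ((n + 1 : ℕ) : ℤ) + 1 = a + 1 + n + 1 := by push_cast; ring
    rw [e1]
    congr 3
    ext s; simp only [Set.mem_inter_iff, Set.mem_Icc]; push_cast; omega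

theorem winLaw_left (hm : stepKernel P ∘ₘ m = m) (a : ℤ) (n i : ℕ) :
    (winLaw P m a (i + n)).map (keep (Set.Icc (a + i) (a + i + n))) = winLaw P m (a + i) n := by
  induction i generalizing a with
  | zero =>
    have := winLaw_self P m a n
    simpa using this
  | succ i ih =>
    have h1 := winLaw_left1 P m hm a (i + n)
    have h2 := ih (a + 1)
    rw [← h1, map_keep_keep] at h2
    have e1 : a + 1 + (i : ℤ) = a + ((i + 1 : ℕ) : ℤ) := by push_cast; ring
    have e2 : i + n + 1 = i + 1 + n := by ring
    rw [e1, e2] at h2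
    rw [← h2]
    congr 2
    ext s; simp only [Set.mem_inter_iff, Set.mem_Icc]; push_cast; omega

theorem winLaw_sub (hm : stepKernel P ∘ₘ m = m) {a b : ℤ} {j k : ℕ} (h1 : b ≤ a)
    (h2 : a + k ≤ b + j) :
    (winLaw P m b j).map (keep (Set.Icc a (a + k))) = winLaw P m a k := by
  obtain ⟨i, rfl⟩ : ∃ i : ℕ, a = b + i := ⟨(a - b).toNat, by omega⟩
  obtain ⟨l, rfl⟩ : ∃ l : ℕ, j = i + k + l := ⟨j - (i + k), by omega⟩
  rw [← winLaw_left P m hm b k i, ← winLaw_right P m b (i + k) l, map_keep_keep]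
  congr 2
  ext s; simp only [Set.mem_inter_iff, Set.mem_Icc]; push_cast; omega

theorem winLaw_zshift (a : ℤ) (n : ℕ) :
    (winLaw P m (a + 1) n).map zshift = winLaw P m a n := by
  induction n with
  | zero =>
    rw [winLaw, winLaw, Measure.map_map measurable_zshift (measurable_embedAt _)]
    congr 1
    funext p
    exact zshift_embedAt a p
  | succ n ih =>
    rw [winLaw, winLaw, ← ih, ← resample_zshift]
    congr 3
    ring

/-- solution property in terms of laws of pasts. -/
def SolLaw (μ : Measure (ℤ → ℝ × F)) : Prop :=
  ∀ t, μ.map (keep (Set.Iio (t + 1))) = resample P t ∘ₘ μ.map (keep (Set.Iio t))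

/-- all windows have the right law -/
def HasWin (μ : Measure (ℤ → ℝ × F)) : Prop :=
  ∀ a (k : ℕ), μ.map (keep (Set.Icc a (a + k))) = winLaw P m a k

variable {P m}

theorem HasWin.eq {μ ν : Measure (ℤ → ℝ × F)} [IsFiniteMeasure μ] [IsFiniteMeasure ν]
    (h : HasWin P m μ) (h' : HasWin P m ν) : μ = ν := by
  refine ext_of_window 0 fun n _ => ?_
  have := h (-n) (2 * n)
  rw [← h' (-n) (2 * n)] at this
  have e : -(n : ℤ) + ((2 * n : ℕ) : ℤ) = n := by push_cast; ring
  rwa [e] at this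

theorem HasWin.shift {μ : Measure (ℤ → ℝ × F)} [IsFiniteMeasure μ] (h : HasWin P m μ) :
    μ.map zshift = μ := by
  refine HasWin.eq (P := P) (m := m) ?_ h
  intro a k
  rw [← winLaw_zshift, ← h (a + 1) k, Measure.map_map (measurable_keep _) measurable_zshift,
    Measure.map_map measurable_zshift (measurable_keep _)]
  congr 1
  funext z
  rw [Function.comp_apply, Function.comp_apply, zshift_keep]
  congr 3; omega

theorem measurable_env : Measurable (fun (z : ℤ → ℝ × F) => fun t => (z t).2) :=
  measurable_pi_lambda _ fun t => measurable_snd.comp (measurable_pi_apply t)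

theorem HasWin.env {μ : Measure (ℤ → ℝ × F)} (h : HasWin P m μ) :
    μ.map (fun z => fun t => (z t).2) = m.map Prod.fst := by
  have h0 := h 0 0
  have h1 := congrArg (Measure.map (fun z => fun t => (z t).2)) h0
  rw [Measure.map_map measurable_env (measurable_keep _), winLaw,
    Measure.map_map measurable_env (measurable_embedAt _)] at h1
  have e2 : (fun z t => (z t).2) ∘ embedAt 0 = (Prod.fst : (ℤ → F) × ℝ → _) := by
    funext p t
    simp [embedAt]
  rw [e2] at h1
  exact h1

theorem HasWin.sol {μ : Measure (ℤ → ℝ × F)} [IsFiniteMeasure μ] (h : HasWin P m μ) :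
    SolLaw P μ := by
  intro t
  refine ext_of_window (t.natAbs + 1) fun n hn => ?_
  rw [resample_keep P t (by simp only [Set.mem_Icc]; omega) (by simp only [Set.mem_Icc]; omega),
    map_keep_keep, map_keep_keep]
  obtain ⟨k, hk⟩ : ∃ k : ℕ, t = -(n : ℤ) + k + 1 := ⟨(t + n - 1).toNat, by omega⟩
  have e1 : Set.Icc (-(n : ℤ)) n ∩ Set.Iio (t + 1) = Set.Icc (-(n : ℤ)) (-(n : ℤ) + (k + 1 : ℕ)) := by
    ext s; simp only [Set.mem_inter_iff, Set.mem_Icc, Set.mem_Iio]; push_cast; omega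
  have e2 : Set.Icc (-(n : ℤ)) n ∩ Set.Iio t = Set.Icc (-(n : ℤ)) (-(n : ℤ) + k) := by
    ext s; simp only [Set.mem_inter_iff, Set.mem_Icc, Set.mem_Iio]; omega
  rw [e1, e2, h, h, winLaw, hk]

theorem SolLaw.hasWin {μ : Measure (ℤ → ℝ × F)} (h : SolLaw P μ)
    (hs : ∀ a, μ.map (stateAt a) = m) : HasWin P m μ := by
  intro a k
  induction k with
  | zero =>
    rw [winLaw, ← hs a, Measure.map_map (measurable_embedAt _) (measurable_stateAt _)]
    congr 1
    funext z
    rw [Function.comp_apply, embedAt_stateAt]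
    simp
  | succ k ih =>
    have h1 := congrArg (Measure.map (keep (Set.Icc a (a + (k + 1 : ℕ))))) (h (a + k + 1))
    rw [resample_keep P _ (by simp only [Set.mem_Icc]; push_cast; omega)
      (by simp only [Set.mem_Icc]; push_cast; omega), map_keep_keep, map_keep_keep] at h1
    rw [winLaw, ← ih]
    convert h1 using 3
    · congr 1
      ext s; simp only [Set.mem_inter_iff, Set.mem_Icc, Set.mem_Iio]; push_cast; omega
    · congr 1
      ext s; simp only [Set.mem_inter_iff, Set.mem_Icc, Set.mem_Iio]; push_cast; omega

theorem stateAt_of_stat {μ : Measure (ℤ → ℝ × F)} (hμ : μ.map zshift = μ) (a : ℤ) :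
    μ.map (stateAt (a + 1)) = μ.map (stateAt a) := by
  conv_rhs => rw [← hμ]
  rw [Measure.map_map (measurable_stateAt _) measurable_zshift]
  congr 1
  funext z
  exact (stateAt_zshift a z).symm

theorem SolLaw.invariant {μ : Measure (ℤ → ℝ × F)} (h : SolLaw P μ) (hμ : μ.map zshift = μ) :
    stepKernel P ∘ₘ μ.map (stateAt 0) = μ.map (stateAt 0) := by
  have h1 := congrArg (Measure.map (stateAt 1)) (h 1)
  rw [resample_stateAt, Measure.map_map (measurable_stateAt _) (measurable_keep _),
    Measure.map_map (measurable_stateAt _) (measurable_keep _)] at h1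
  have e1 : (stateAt 1 ∘ keep (Set.Iio ((1 : ℤ) + 1)) : (ℤ → ℝ × F) → _) = stateAt 1 := by
    funext z; exact stateAt_keep _ (by simp) z
  have e2 : (stateAt (1 - 1) ∘ keep (Set.Iio (1 : ℤ)) : (ℤ → ℝ × F) → _) = stateAt 0 := by
    funext z; exact stateAt_keep _ (by simp) z
  rw [e1, e2] at h1
  rw [← h1]
  exact stateAt_of_stat hμ 0

/-- A stationary solution has the prescribed windows. -/
theorem SolLaw.hasWin_of_stat
    (hPpos : ∀ q A, MeasurableSet A → (P q A = 0 ↔ (volume : Measure ℝ) A = 0))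
    [IsFiniteMeasure m] (hm : stepKernel P ∘ₘ m = m)
    {μ : Measure (ℤ → ℝ × F)} [IsFiniteMeasure μ] (h : SolLaw P μ) (hμ : μ.map zshift = μ)
    (hX : μ.map (fun z => fun t => (z t).2) = m.map Prod.fst) : HasWin P m μ := by
  refine h.hasWin ?_
  have h0 : μ.map (stateAt 0) = m := by
    refine invariant_unique P hPpos _ _ (h.invariant hμ) hm ?_
    rw [← hX, Measure.map_map measurable_fst (measurable_stateAt _)]
    congr 1
    funext z t
    simp [stateAt]
  intro a
  induction a using Int.induction_on with
  | zero => exact h0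
  | succ i ih => rw [stateAt_of_stat hμ, ih]
  | pred i ih =>
    have := stateAt_of_stat hμ (-(i : ℤ) - 1)
    rw [← this, sub_add_cancel, ih]

end PathSpace2

end HelpersD2

section HelpersD3
open scoped Topology NNReal

theorem compProd_comap_map {S T U : Type*} [MeasurableSpace S] [MeasurableSpace T]
    [MeasurableSpace U] (ρ : Measure S) [SFinite ρ] (β : Kernel T U) [IsSFiniteKernel β] (e : S → T)
    (he : Measurable e) :
    (ρ ⊗ₘ β.comap e he).map (Prod.map e id) = ρ.map e ⊗ₘ β := by
  have hm : Measurable (Prod.map e (id : U → U)) := he.prodMap measurable_id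
  ext A hA
  rw [Measure.map_apply hm hA, Measure.compProd_apply (hm hA), Measure.compProd_apply hA,
    lintegral_map (f := fun a => β a (Prod.mk a ⁻¹' A))
      (Kernel.measurable_kernel_prodMk_left hA) he]
  rfl

theorem trajMeasure_zero {T : Type*} [MeasurableSpace T] (μ₀ : Measure T) [IsProbabilityMeasure μ₀]
    (κ : (n : ℕ) → Kernel (Π _ : Finset.Iic n, T) T) [∀ n, IsMarkovKernel (κ n)] :
    (Kernel.trajMeasure (X := fun _ => T) μ₀ κ).map (fun x => x 0) = μ₀ := by
  have h : (fun x : ℕ → T => x 0) = (fun y : (Π _ : Finset.Iic 0, T) => y ⟨0, by simp⟩) ∘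
    Preorder.frestrictLe (π := fun _ => T) 0 := rfl
  have hev : Measurable (fun y : (Π _ : Finset.Iic 0, T) => y ⟨0, by simp⟩) :=
    measurable_pi_apply _
  rw [h, ← Measure.map_map hev (Preorder.measurable_frestrictLe _),
    Kernel.trajMeasure, Measure.map_comp _ _ (Preorder.measurable_frestrictLe _),
    Kernel.traj_map_frestrictLe, Kernel.partialTraj_self, Measure.id_comp,
    Measure.map_map hev (MeasurableEquiv.measurable _)]
  have hid : (fun y : (Π _ : Finset.Iic 0, T) => y ⟨0, by simp⟩) ∘
      ⇑(MeasurableEquiv.piUnique fun _ : Finset.Iic 0 => T).symm = id := by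
    funext x
    rfl
  exact (congrArg (fun g => Measure.map g μ₀) hid).trans Measure.map_id

theorem inverse_limit {T : Type*} [MeasurableSpace T] [StandardBorelSpace T] [Nonempty T]
    (Q : ℕ → Measure T) [∀ n, IsProbabilityMeasure (Q n)] (p : ℕ → T → T)
    (hp : ∀ n, Measurable (p n)) (hQ : ∀ n, (Q (n + 1)).map (p n) = Q n) :
    ∃ R : Measure (ℕ → T), IsProbabilityMeasure R ∧ (∀ n, R.map (fun x => x n) = Q n) ∧
      ∀ᵐ x ∂(R), ∀ n, x n = p n (x (n + 1)) := by
  have hg : ∀ n, Measurable fun w => (p n w, w) := fun n => (hp n).prodMk measurable_id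
  set ρ : ℕ → Measure (T × T) := fun n => (Q (n + 1)).map fun w => (p n w, w) with hρ
  have hρp : ∀ n, IsProbabilityMeasure (ρ n) := fun n =>
    Measure.isProbabilityMeasure_map (hg n).aemeasurable
  have hρfst : ∀ n, (ρ n).fst = Q n := by
    intro n
    rw [Measure.fst, hρ, Measure.map_map measurable_fst (hg n), ← hQ n]
    rfl
  have hdis : ∀ n, Q n ⊗ₘ (ρ n).condKernel = ρ n := by
    intro n
    rw [← hρfst n]
    exact (ρ n).disintegrate _
  have hev : ∀ n : ℕ, Measurable fun y : (Π _ : Finset.Iic n, T) => y ⟨n, by simp⟩ := fun n =>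
    measurable_pi_apply _
  set κ : (n : ℕ) → Kernel (Π _ : Finset.Iic n, T) T := fun n =>
    ((ρ n).condKernel).comap (fun y => y ⟨n, by simp⟩) (hev n) with hκ
  have hκm : ∀ n, IsMarkovKernel (κ n) := fun n => by rw [hκ]; infer_instance
  set R := Kernel.trajMeasure (X := fun _ => T) (Q 0) κ with hR
  have hRp : IsProbabilityMeasure R := by rw [hR]; infer_instance
  have hpair : ∀ n, R.map (fun x => (x n, x (n + 1))) = R.map (fun x => x n) ⊗ₘ (ρ n).condKernel := by
    intro n
    have h1 := Kernel.map_frestrictLe_trajMeasure_compProd_eq_map_trajMeasure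
      (X := fun _ => T) (κ := κ) (μ₀ := Q 0) (a := n)
    rw [← hR] at h1
    have h2 := compProd_comap_map (R.map (Preorder.frestrictLe (π := fun _ => T) n))
      ((ρ n).condKernel) (fun y => y ⟨n, by simp⟩) (hev n)
    rw [Measure.map_map (hev n) (Preorder.measurable_frestrictLe _)] at h2
    refine Eq.trans ?_ h2
    have h3 := congrArg (Measure.map (Prod.map
      (fun y : (Π _ : Finset.Iic n, T) => y ⟨n, by simp⟩) (id : T → T))) h1
    refine Eq.trans ?_ h3.symm
    rw [Measure.map_map ((hev n).prodMap measurable_id)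
      ((Preorder.measurable_frestrictLe _).prodMk (measurable_pi_apply _))]
    rfl
  have hpm : ∀ n : ℕ, Measurable fun x : ℕ → T => (x n, x (n + 1)) := fun n =>
    (measurable_pi_apply _).prodMk (measurable_pi_apply _)
  have hmarg : ∀ n, R.map (fun x => x n) = Q n := by
    intro n
    induction n with
    | zero => exact trajMeasure_zero (Q 0) κ
    | succ n ih =>
      have h1 := hpair n
      rw [ih, hdis] at h1
      have h2 := congrArg (Measure.map Prod.snd) h1
      rw [hρ, Measure.map_map measurable_snd (hg n), Measure.map_map measurable_snd (hpm n)] at h2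
      refine Eq.trans ?_ (h2.trans ?_)
      · rfl
      · exact Measure.map_id
  refine ⟨R, hRp, hmarg, ?_⟩
  rw [ae_all_iff]
  intro n
  have h1 := hpair n
  rw [hmarg n, hdis] at h1
  have hms : MeasurableSet {q : T × T | q.1 = p n q.2} :=
    measurableSet_eq_fun measurable_fst ((hp n).comp measurable_snd)
  have h2 : ∀ᵐ q ∂(ρ n), q.1 = p n q.2 := by
    rw [hρ, ae_map_iff (hg n).aemeasurable hms]
    exact Eventually.of_forall fun w => rfl
  rw [← h1, ae_map_iff (hpm n).aemeasurable hms] at h2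
  exact h2

theorem exists_hasWin {F : Type*} [MeasurableSpace F] [StandardBorelSpace F] [Nonempty F]
    (P : Kernel (F × ℝ) ℝ) [IsMarkovKernel P] (m : Measure ((ℤ → F) × ℝ)) [IsProbabilityMeasure m]
    (hm : stepKernel P ∘ₘ m = m) :
    ∃ μ : Measure (ℤ → ℝ × F), IsProbabilityMeasure μ ∧ HasWin P m μ := by
  set D : ℕ → Set ℤ := fun n => Set.Icc (-(n : ℤ)) n with hD
  have eD : ∀ n : ℕ, Set.Icc (-(n : ℤ)) (-(n : ℤ) + (2 * n : ℕ)) = D n := by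
    intro n; rw [hD]; congr 1; push_cast; ring
  obtain ⟨R, hRp, hmarg, hae⟩ := inverse_limit (T := ℤ → ℝ × F)
    (fun n => winLaw P m (-(n : ℤ)) (2 * n)) (fun n => keep (D n)) (fun n => measurable_keep _)
    (by
      intro n
      rw [← eD]
      exact winLaw_sub P m hm (by push_cast; omega) (by push_cast; omega))
  set Φ : (ℕ → ℤ → ℝ × F) → ℤ → ℝ × F := fun w t => w t.natAbs t with hΦ
  have hΦm : Measurable Φ := measurable_pi_lambda _ fun t =>
    (measurable_pi_apply t).comp (measurable_pi_apply t.natAbs)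
  have hmem : ∀ (n : ℕ) (t : ℤ), t ∈ D n ↔ t.natAbs ≤ n := by
    intro n t; rw [hD]; simp only [Set.mem_Icc]; omega
  have hk : ∀ w : ℕ → ℤ → ℝ × F, (∀ n, w n = keep (D n) (w (n + 1))) → ∀ n, keep (D n) (Φ w) = w n := by
    intro w hw n
    have h2 : ∀ i j t, (w (i + j) t).2 = (w i t).2 := by
      intro i j t
      induction j with
      | zero => rfl
      | succ j ih => rw [← ih, hw (i + j), keep_snd]; rfl
    have h1 : ∀ i j t, t ∈ D i → w (i + j) t = w i t := by
      intro i j t ht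
      induction j with
      | zero => rfl
      | succ j ih =>
        rw [← ih, hw (i + j), keep_of_mem]
        · rfl
        · rw [hmem] at ht ⊢; omega
    have h2' : ∀ i j t, (w i t).2 = (w j t).2 := by
      intro i j t
      have a := h2 0 i t
      have b := h2 0 j t
      rw [zero_add] at a b
      rw [a, b]
    funext t
    by_cases ht : t ∈ D n
    · rw [keep_of_mem _ ht]
      obtain ⟨j, hj⟩ := Nat.exists_eq_add_of_le ((hmem n t).1 ht)
      have := h1 t.natAbs j t ((hmem _ _).2 le_rfl)
      rw [hj, this]
    · refine Prod.ext ?_ ?_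
      · rw [keep_fst_of_notMem _ ht, hw n, keep_fst_of_notMem _ ht]
      · rw [keep_snd]; exact h2' _ _ _
  refine ⟨R.map Φ, Measure.isProbabilityMeasure_map hΦm.aemeasurable, ?_⟩
  have hQ : ∀ n : ℕ, (R.map Φ).map (keep (D n)) = winLaw P m (-(n : ℤ)) (2 * n) := by
    intro n
    rw [Measure.map_map (measurable_keep _) hΦm, ← hmarg n]
    refine Measure.map_congr ?_
    filter_upwards [hae] with w hw
    exact hk w hw n
  intro a k
  set n := a.natAbs + k with hn
  have h := winLaw_sub P m hm (a := a) (b := -(n : ℤ)) (j := 2 * n) (k := k) (by omega)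
    (by push_cast; omega)
  rw [← h, ← hQ n, map_keep_keep]
  congr 2
  ext s; rw [Set.mem_inter_iff, hmem]; simp only [Set.mem_Icc]; omega

end HelpersD3

section HelpersD4
open scoped Topology NNReal

section Sol
variable {F : Type*} [MeasurableSpace F]
variable (P : Kernel (F × ℝ) ℝ) [IsMarkovKernel P]

/-- solution property through rectangles. -/
def SolRect (μ : Measure (ℤ → ℝ × F)) : Prop :=
  ∀ (t : ℤ) (C : Set (ℤ → ℝ × F)) (A : Set ℝ), MeasurableSet C → MeasurableSet A →
    μ (keep (Set.Iio t) ⁻¹' C ∩ {z | (z t).1 ∈ A}) =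
      ∫⁻ z in keep (Set.Iio t) ⁻¹' C, P (prevQ t z) A ∂μ

theorem prevQ_keep (t : ℤ) (z : ℤ → ℝ × F) : prevQ t (keep (Set.Iio t) z) = prevQ t z := by
  unfold prevQ
  rw [keep_of_mem z (show t - 1 ∈ Set.Iio t by simp)]

theorem measurable_Y (t : ℤ) : Measurable fun z : ℤ → ℝ × F => (z t).1 :=
  measurable_fst.comp (measurable_pi_apply t)

theorem solLaw_aux (t : ℤ) (μ : Measure (ℤ → ℝ × F)) [IsFiniteMeasure μ] (C : Set (ℤ → ℝ × F))
    (A : Set ℝ) (hC : MeasurableSet C) (hA : MeasurableSet A) :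
    ((μ.map (keep (Set.Iio t))) ⊗ₘ condY P t) (C ×ˢ A) =
      ∫⁻ z in keep (Set.Iio t) ⁻¹' C, P (prevQ t z) A ∂μ := by
  rw [Measure.compProd_apply_prod hC hA, setLIntegral_map hC ((condY P t).measurable_coe hA)
    (measurable_keep _)]
  refine lintegral_congr fun z => ?_
  rw [condY, Kernel.comap_apply, prevQ_keep]

theorem SolRect.solLaw {μ : Measure (ℤ → ℝ × F)} [IsFiniteMeasure μ] (h : SolRect P μ) :
    SolLaw P μ := by
  intro t
  have hpm : Measurable fun z : ℤ → ℝ × F => (keep (Set.Iio t) z, (z t).1) :=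
    (measurable_keep _).prodMk (measurable_Y t)
  have h1 : μ.map (fun z => (keep (Set.Iio t) z, (z t).1)) =
      (μ.map (keep (Set.Iio t))) ⊗ₘ condY P t := by
    refine Measure.ext_prod fun {C A} hC hA => ?_
    rw [solLaw_aux P t μ C A hC hA, ← h t C A hC hA, Measure.map_apply hpm (hC.prod hA)]
    rfl
  rw [resample_comp, ← h1, Measure.map_map (measurable_setY t) hpm]
  congr 1
  funext z s
  by_cases hs : s = t
  · subst hs; simp [keep, setY]
  · have : s ∈ Set.Iio (t + 1) ↔ s ∈ Set.Iio t := by simp only [Set.mem_Iio]; omega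
    by_cases h2 : s ∈ Set.Iio t
    · simp only [keep, setY, Function.comp_apply, Function.update_of_ne hs,
        Set.indicator_of_mem h2, Set.indicator_of_mem (this.2 h2)]
    · simp only [keep, setY, Function.comp_apply, Function.update_of_ne hs,
        Set.indicator_of_notMem h2, Set.indicator_of_notMem (fun h' => h2 (this.1 h'))]

theorem SolLaw.solRect {μ : Measure (ℤ → ℝ × F)} [IsFiniteMeasure μ] (h : SolLaw P μ) :
    SolRect P μ := by
  intro t C A hC hA
  have hpm : Measurable fun z : ℤ → ℝ × F => (keep (Set.Iio t) z, (z t).1) :=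
    (measurable_keep _).prodMk (measurable_Y t)
  have h1 := congrArg (fun ν => Measure.map (fun z => (keep (Set.Iio t) z, (z t).1)) ν (C ×ˢ A)) (h t)
  rw [Measure.map_map hpm (measurable_keep _), resample_comp, Measure.map_map hpm (measurable_setY t),
    Measure.map_apply (hpm.comp (measurable_keep _)) (hC.prod hA)] at h1
  have e1 : ((fun z : ℤ → ℝ × F => (keep (Set.Iio t) z, (z t).1)) ∘ keep (Set.Iio (t + 1))) ⁻¹'
      (C ×ˢ A) = keep (Set.Iio t) ⁻¹' C ∩ {z | (z t).1 ∈ A} := by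
    ext z
    have e2 : Set.Iio t ∩ Set.Iio (t + 1) = Set.Iio t := by
      ext s; simp only [Set.mem_inter_iff, Set.mem_Iio]; omega
    simp only [Set.mem_preimage, Function.comp_apply, keep_keep, e2,
      keep_of_mem z (show t ∈ Set.Iio (t + 1) by simp), Set.mem_prod]
    rfl
  rw [e1] at h1
  rw [h1, ← solLaw_aux P t μ C A hC hA]
  -- the support
  have e3 : (μ.map (keep (Set.Iio t))) ⊗ₘ condY P t =
      (μ ⊗ₘ condY P t).map (Prod.map (keep (Set.Iio t)) id) := by
    rw [← compProd_comap_map _ _ _ (measurable_keep _)]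
    congr 2
    ext z : 1
    rw [condY, Kernel.comap_apply, Kernel.comap_apply, Kernel.comap_apply, prevQ_keep]
  rw [e3, Measure.map_map (hpm.comp (measurable_setY t))
    ((measurable_keep _).prodMap measurable_id)]
  congr 2
  funext p
  refine Prod.ext ?_ ?_
  · funext s
    by_cases hs : s = t
    · subst hs; simp [keep, setY]
    · simp [keep, setY, hs, Set.indicator]
      intro h1 h2; omega
  · simp [setY]

theorem histSigma_eq (t : ℤ) : histSigma ℝ F t =
    MeasurableSpace.comap (keep (Set.Iio t) : (ℤ → ℝ × F) → _) inferInstance := by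
  unfold histSigma
  set g := (fun z => ((fun s => (z s).2, fun s : {s : ℤ // s < t} => (z s.1).1) :
      (ℤ → F) × ({s : ℤ // s < t} → ℝ)) : (ℤ → ℝ × F) → _) with hg
  have hgm : Measurable g := by
    refine Measurable.prodMk measurable_env ?_
    exact measurable_pi_lambda _ fun s => measurable_Y s.1
  refine le_antisymm ?_ ?_
  · have h1 : g = g ∘ keep (Set.Iio t) := by
      funext z
      refine Prod.ext rfl ?_
      funext s
      show (z s.1).1 = (keep (Set.Iio t) z s.1).1
      rw [keep_of_mem z (show s.1 ∈ Set.Iio t from s.2)]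
    rw [h1, ← MeasurableSpace.comap_comp]
    exact MeasurableSpace.comap_mono hgm.comap_le
  · set h : (ℤ → F) × ({s : ℤ // s < t} → ℝ) → ℤ → ℝ × F := fun p s =>
      (if hs : s < t then p.2 ⟨s, hs⟩ else 0, p.1 s) with hh
    have hhm : Measurable h := by
      refine measurable_pi_lambda _ fun s => ?_
      refine Measurable.prodMk ?_ ((measurable_pi_apply s).comp measurable_fst)
      by_cases hs : s < t
      · simp only [hs, dif_pos]
        exact (measurable_pi_apply _).comp measurable_snd
      · simp only [hs, dif_neg, not_false_eq_true]
        exact measurable_const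
    have h1 : keep (Set.Iio t) = h ∘ g := by
      funext z s
      by_cases hs : s < t
      · simp [keep, hh, hg, hs]
      · simp [keep, hh, hg, hs]
    rw [h1, ← MeasurableSpace.comap_comp]
    exact MeasurableSpace.comap_mono hhm.comap_le

theorem isMCRESolution_iff (μ : Measure (ℤ → ℝ × F)) [IsProbabilityMeasure μ] :
    IsMCRESolution P μ ↔ SolRect P μ := by
  have hm : ∀ t, histSigma ℝ F t ≤ MeasurableSpace.pi := by
    intro t; rw [histSigma_eq]; exact (measurable_keep _).comap_le
  have hYA : ∀ (t : ℤ) (A : Set ℝ), MeasurableSet A → MeasurableSet {z : ℤ → ℝ × F | (z t).1 ∈ A} :=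
    fun t A hA => measurable_Y t hA
  have hPm : ∀ (t : ℤ) (A : Set ℝ), MeasurableSet A →
      Measurable fun z : ℤ → ℝ × F => P (prevQ t z) A := fun t A hA =>
    (P.measurable_coe hA).comp (measurable_prevQ t)
  have hi : ∀ (t : ℤ) (A : Set ℝ), MeasurableSet A → Integrable
      (({z : ℤ → ℝ × F | (z t).1 ∈ A}).indicator (fun _ => (1 : ℝ))) μ := fun t A hA =>
    (integrable_const 1).indicator (hYA t A hA)
  have hleft : ∀ (t : ℤ) (A : Set ℝ), MeasurableSet A → ∀ s : Set (ℤ → ℝ × F), MeasurableSet s →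
      ∫ z in s, ({z : ℤ → ℝ × F | (z t).1 ∈ A}).indicator (fun _ => (1 : ℝ)) z ∂μ =
        (μ (s ∩ {z | (z t).1 ∈ A})).toReal := by
    intro t A hA s hs
    rw [setIntegral_indicator (hYA t A hA)]
    simp [Measure.real]
  have hright : ∀ (t : ℤ) (A : Set ℝ), MeasurableSet A → ∀ s : Set (ℤ → ℝ × F), MeasurableSet s →
      ∫ z in s, (P ((z (t - 1)).2, (z (t - 1)).1) A).toReal ∂μ =
        (∫⁻ z in s, P (prevQ t z) A ∂μ).toReal := by
    intro t A hA s hs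
    exact integral_toReal (hPm t A hA).aemeasurable
      (Eventually.of_forall fun z => measure_lt_top _ _)
  have hfin : ∀ (t : ℤ) (A : Set ℝ) (s : Set (ℤ → ℝ × F)), ∫⁻ z in s, P (prevQ t z) A ∂μ ≠ ∞ := by
    intro t A s
    refine ne_top_of_le_ne_top (b := ∫⁻ z in s, 1 ∂μ) (by simp) ?_
    exact lintegral_mono fun z => prob_le_one
  constructor
  · intro h t C A hC hA
    have hs : MeasurableSet[histSigma ℝ F t] (keep (Set.Iio t) ⁻¹' C) := by
      rw [histSigma_eq]; exact ⟨C, hC, rfl⟩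
    have h1 := setIntegral_condExp (hm t) (hi t A hA) hs
    rw [setIntegral_congr_ae (hm t _ hs) ((h t A hA).mono fun z hz _ => hz),
      hleft t A hA _ (hm t _ hs), hright t A hA _ (hm t _ hs)] at h1
    exact ((ENNReal.toReal_eq_toReal_iff' (hfin t A _) (measure_ne_top _ _)).1 h1).symm
  · intro h t A hA
    refine (ae_eq_condExp_of_forall_setIntegral_eq (hm t) (hi t A hA) ?_ ?_ ?_).symm
    · intro s hs _
      refine Integrable.integrableOn ?_
      refine Integrable.of_bound (C := 1) ((hPm t A hA).ennreal_toReal.aestronglyMeasurable) ?_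
      refine Eventually.of_forall fun z => ?_
      rw [Real.norm_of_nonneg ENNReal.toReal_nonneg]
      exact ENNReal.toReal_le_of_le_ofReal zero_le_one (by simpa using prob_le_one)
    · intro s hs _
      rw [hleft t A hA s (hm t s hs), hright t A hA s (hm t s hs)]
      rw [histSigma_eq] at hs
      obtain ⟨C, hC, rfl⟩ := hs
      rw [h t C A hC hA]
    · refine StronglyMeasurable.aestronglyMeasurable ?_
      refine Measurable.stronglyMeasurable ?_
      have : (fun z : ℤ → ℝ × F => (P ((z (t - 1)).2, (z (t - 1)).1) A).toReal) =
          (fun z => (P (prevQ t z) A).toReal) ∘ keep (Set.Iio t) := by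
        funext z
        rw [Function.comp_apply, prevQ_keep]; rfl
      rw [this, histSigma_eq]
      exact (hPm t A hA).ennreal_toReal.comp (comap_measurable _)

end Sol

end HelpersD4

section HelpersE1
open scoped Topology NNReal symmDiff

section Erg
variable {F : Type*} [MeasurableSpace F]

/-- translation by `c` -/
def shiftBy {α : Type*} (c : ℤ) (z : ℤ → α) : ℤ → α := fun t => z (t + c)

theorem measurable_shiftBy {α : Type*} [MeasurableSpace α] (c : ℤ) :
    Measurable (shiftBy c : (ℤ → α) → ℤ → α) :=
  measurable_pi_lambda _ fun t => measurable_pi_apply (t + c)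

theorem shiftBy_zshift {α : Type*} (n : ℕ) (z : ℤ → α) :
    shiftBy (-((n + 1 : ℕ) : ℤ)) (zshift z) = shiftBy (-(n : ℤ)) z := by
  funext t
  simp only [shiftBy, zshift]
  congr 1
  push_cast; ring

theorem map_shiftBy {α : Type*} [MeasurableSpace α] {μ : Measure (ℤ → α)} (hμ : μ.map zshift = μ)
    (n : ℕ) : μ.map (shiftBy (-(n : ℤ))) = μ := by
  induction n with
  | zero =>
    have : (shiftBy (-((0 : ℕ) : ℤ)) : (ℤ → α) → _) = id := by
      funext z t; simp [shiftBy]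
    rw [this, Measure.map_id]
  | succ n ih =>
    conv_lhs => rw [← hμ]
    rw [Measure.map_map (measurable_shiftBy _) measurable_zshift]
    have : (shiftBy (-((n + 1 : ℕ) : ℤ)) ∘ zshift : (ℤ → α) → _) = shiftBy (-(n : ℤ)) := by
      funext z; exact shiftBy_zshift n z
    rw [this, ih]

theorem preimage_shiftBy {α : Type*} {A : Set (ℤ → α)} (hA : zshift ⁻¹' A = A)
    (n : ℕ) : shiftBy (-(n : ℤ)) ⁻¹' A = A := by
  induction n with
  | zero =>
    ext z
    have : shiftBy (-((0 : ℕ) : ℤ)) z = z := by funext t; simp [shiftBy]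
    rw [Set.mem_preimage, this]
  | succ n ih =>
    have h : zshift ⁻¹' (shiftBy (-((n + 1 : ℕ) : ℤ)) ⁻¹' A) = A := by
      ext z
      rw [Set.mem_preimage, Set.mem_preimage, shiftBy_zshift, ← Set.mem_preimage, ih]
    -- surjectivity of the shift
    ext z
    set w : ℤ → α := fun t => z (t - 1) with hw
    have hz : zshift w = z := by funext t; simp [zshift, hw]
    have h1 : w ∈ zshift ⁻¹' (shiftBy (-((n + 1 : ℕ) : ℤ)) ⁻¹' A) ↔ w ∈ zshift ⁻¹' A := by
      rw [h, hA]
    rw [Set.mem_preimage, hz, Set.mem_preimage (s := A), Set.mem_preimage, hz] at h1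
    exact h1

theorem past_approx {μ : Measure (ℤ → ℝ × F)} [IsFiniteMeasure μ] (hμ : μ.map zshift = μ)
    {A : Set (ℤ → ℝ × F)} (hA : MeasurableSet A) (hinv : zshift ⁻¹' A = A) (t : ℤ) {ε : ℝ≥0∞}
    (hε : 0 < ε) : ∃ C, MeasurableSet C ∧ μ ((keep (Set.Iio t) ⁻¹' C) ∆ A) < ε := by
  obtain ⟨G, hG, hGA⟩ := exists_measure_symmDiff_lt_of_generateFrom_isSetRing (μ := μ)
    (C := measurableCylinders (fun _ : ℤ => ℝ × F)) isSetRing_measurableCylinders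
    ⟨{Set.univ}, Set.countable_singleton _, by
      rintro s hs; rw [Set.mem_singleton_iff] at hs; rw [hs]; exact univ_mem_measurableCylinders _,
      by simp⟩ generateFrom_measurableCylinders.symm hA hε
  have hGm : MeasurableSet G := MeasurableSet.of_mem_measurableCylinders hG
  obtain ⟨I, S, hS, hGS⟩ := (mem_measurableCylinders G).1 hG
  set n := I.sup Int.natAbs + t.natAbs + 1 with hn
  have hC : MeasurableSet (shiftBy (-(n : ℤ)) ⁻¹' G) := measurable_shiftBy _ hGm
  refine ⟨shiftBy (-(n : ℤ)) ⁻¹' G, hC, ?_⟩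
  have h1 : keep (Set.Iio t) ⁻¹' (shiftBy (-(n : ℤ)) ⁻¹' G) = shiftBy (-(n : ℤ)) ⁻¹' G := by
    ext z
    rw [Set.mem_preimage, Set.mem_preimage, Set.mem_preimage, hGS, mem_cylinder, mem_cylinder]
    have : I.restrict (shiftBy (-(n : ℤ)) (keep (Set.Iio t) z)) =
        I.restrict (shiftBy (-(n : ℤ)) z) := by
      funext s
      have hs : s.1.natAbs ≤ I.sup Int.natAbs := Finset.le_sup (f := Int.natAbs) s.2
      show keep (Set.Iio t) z (s.1 + -(n : ℤ)) = z (s.1 + -(n : ℤ))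
      refine keep_of_mem z ?_
      rw [Set.mem_Iio]; omega
    rw [this]
  have h2 : (shiftBy (-(n : ℤ)) ⁻¹' G) ∆ A = shiftBy (-(n : ℤ)) ⁻¹' (G ∆ A) := by
    rw [Set.preimage_symmDiff, preimage_shiftBy hinv]
  rw [h1, h2, ← Measure.map_apply (measurable_shiftBy _) (hGm.symmDiff hA), map_shiftBy hμ]
  exact hGA

variable (P : Kernel (F × ℝ) ℝ) [IsMarkovKernel P]

theorem SolRect.restrict {μ : Measure (ℤ → ℝ × F)} [IsFiniteMeasure μ] (h : SolRect P μ)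
    (hμ : μ.map zshift = μ) {A : Set (ℤ → ℝ × F)} (hA : MeasurableSet A)
    (hinv : zshift ⁻¹' A = A) : SolRect P (μ.restrict A) := by
  intro t C B hC hB
  have hCm := measurable_keep (F := F) (Set.Iio t) hC
  set V : Set (ℤ → ℝ × F) := {z | (z t).1 ∈ B} with hV
  have hVm : MeasurableSet V := measurable_Y t hB
  rw [Measure.restrict_apply (hCm.inter hVm), Measure.restrict_restrict hCm]
  set U := keep (Set.Iio t) ⁻¹' C with hU
  set g : (ℤ → ℝ × F) → ℝ≥0∞ := fun z => P (prevQ t z) B with hg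
  have hg1 : ∀ z, g z ≤ 1 := fun z => prob_le_one
  have hIntg : ∀ G H : Set (ℤ → ℝ × F), ∫⁻ z in U ∩ G, g z ∂μ ≤ ∫⁻ z in U ∩ H, g z ∂μ + μ (G ∆ H) := by
    intro G H
    have hsub : U ∩ G ⊆ (U ∩ H) ∪ (G ∆ H) := by
      rintro z ⟨h1, h2⟩
      by_cases h3 : z ∈ H
      · exact Or.inl ⟨h1, h3⟩
      · exact Or.inr (Or.inl ⟨h2, h3⟩)
    refine (lintegral_mono_set hsub).trans ((lintegral_union_le _ _ _).trans ?_)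
    refine add_le_add le_rfl ?_
    calc ∫⁻ z in G ∆ H, g z ∂μ ≤ ∫⁻ _ in G ∆ H, 1 ∂μ := lintegral_mono fun z => hg1 z
      _ = μ (G ∆ H) := by simp
  have hmeas : ∀ G H : Set (ℤ → ℝ × F), μ (U ∩ V ∩ G) ≤ μ (U ∩ V ∩ H) + μ (G ∆ H) := by
    intro G H
    have hsub : U ∩ V ∩ G ⊆ (U ∩ V ∩ H) ∪ (G ∆ H) := by
      rintro z ⟨h1, h2⟩
      by_cases h3 : z ∈ H
      · exact Or.inl ⟨h1, h3⟩
      · exact Or.inr (Or.inl ⟨h2, h3⟩)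
    exact (measure_mono hsub).trans (measure_union_le _ _)
  have heq : ∀ D, MeasurableSet D → μ (U ∩ V ∩ (keep (Set.Iio t) ⁻¹' D)) =
      ∫⁻ z in U ∩ (keep (Set.Iio t) ⁻¹' D), g z ∂μ := by
    intro D hD
    have h1 := h t (C ∩ D) B (hC.inter hD) hB
    rw [Set.preimage_inter] at h1
    rw [← h1]
    congr 1
    ext z; simp only [Set.mem_inter_iff]; tauto
  refine le_antisymm ?_ ?_
  · refine ENNReal.le_of_forall_pos_le_add fun ε hε _ => ?_
    have hε2 : (0 : ℝ≥0∞) < ε / 2 := ENNReal.half_pos (by exact_mod_cast hε.ne')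
    obtain ⟨D, hD, hDA⟩ := past_approx hμ hA hinv t hε2
    have a1 := hmeas A (keep (Set.Iio t) ⁻¹' D)
    have a2 := hIntg (keep (Set.Iio t) ⁻¹' D) A
    rw [heq D hD] at a1
    rw [symmDiff_comm] at a1
    calc _ ≤ _ := a1
      _ ≤ (∫⁻ z in U ∩ A, g z ∂μ + ε / 2) + ε / 2 :=
        add_le_add (a2.trans (add_le_add le_rfl hDA.le)) hDA.le
      _ = _ := by rw [add_assoc, ENNReal.add_halves]
  · refine ENNReal.le_of_forall_pos_le_add fun ε hε _ => ?_
    have hε2 : (0 : ℝ≥0∞) < ε / 2 := ENNReal.half_pos (by exact_mod_cast hε.ne')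
    obtain ⟨D, hD, hDA⟩ := past_approx hμ hA hinv t hε2
    have a1 := hIntg A (keep (Set.Iio t) ⁻¹' D)
    have a2 := hmeas (keep (Set.Iio t) ⁻¹' D) A
    rw [← heq D hD] at a1
    rw [symmDiff_comm] at a1
    calc _ ≤ _ := a1
      _ ≤ (μ (U ∩ V ∩ A) + ε / 2) + ε / 2 :=
        add_le_add (a2.trans (add_le_add le_rfl hDA.le)) hDA.le
      _ = _ := by rw [add_assoc, ENNReal.add_halves]

theorem SolRect.smul {μ : Measure (ℤ → ℝ × F)} (h : SolRect P μ) (c : ℝ≥0∞) :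
    SolRect P (c • μ) := by
  intro t C B hC hB
  rw [Measure.smul_apply, h t C B hC hB, Measure.restrict_smul, lintegral_smul_measure]

theorem ergodic_of_unique
    (hPpos : ∀ q A, MeasurableSet A → (P q A = 0 ↔ (volume : Measure ℝ) A = 0))
    (m : Measure ((ℤ → F) × ℝ)) [IsProbabilityMeasure m] (hm : stepKernel P ∘ₘ m = m)
    (herg : Ergodic zshift (m.map Prod.fst))
    {μ : Measure (ℤ → ℝ × F)} [IsProbabilityMeasure μ] (hw : HasWin P m μ) : Ergodic zshift μ := by
  have hstat := hw.shift
  have hsol := hw.sol.solRect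
  have hmp : MeasurePreserving zshift μ μ := ⟨measurable_zshift, hstat⟩
  refine { toMeasurePreserving := hmp, aeconst_set := ?_ }
  intro A hA hinv
  rw [eventuallyConst_set]
  by_cases h0 : μ A = 0
  · right
    exact measure_eq_zero_iff_ae_notMem.1 h0
  left
  set μA := (μ A)⁻¹ • μ.restrict A with hμA
  have hprob : IsProbabilityMeasure μA := by
    constructor
    rw [hμA, Measure.smul_apply, Measure.restrict_apply_univ, smul_eq_mul]
    exact ENNReal.inv_mul_cancel h0 (measure_ne_top _ _)
  have hstatA : μA.map zshift = μA := by
    rw [hμA, Measure.map_smul]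
    congr 1
    have := (hmp.restrict_preimage hA).map_eq
    rwa [hinv] at this
  have hsolA : SolLaw P μA := ((hsol.restrict P hstat hA hinv).smul P _).solLaw
  have hac : μA ≪ μ := by
    rw [hμA]
    exact (Measure.smul_absolutelyContinuous).trans Measure.restrict_le_self.absolutelyContinuous
  have hX : μA.map (fun z => fun t => (z t).2) = m.map Prod.fst := by
    have hp1 : IsProbabilityMeasure (μA.map (fun z => fun t => (z t).2)) :=
      Measure.isProbabilityMeasure_map measurable_env.aemeasurable
    have hp2 : IsProbabilityMeasure (m.map Prod.fst) :=
      Measure.isProbabilityMeasure_map measurable_fst.aemeasurable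
    refine herg.eq_of_absolutelyContinuous ⟨measurable_zshift, ?_⟩ ?_
    · rw [Measure.map_map measurable_zshift measurable_env]
      conv_rhs => rw [← hstatA]
      rw [Measure.map_map measurable_env measurable_zshift]
      rfl
    · rw [← hw.env]
      exact hac.map measurable_env
  have hwA := hsolA.hasWin_of_stat hPpos hm hstatA hX
  have heq : μA = μ := hwA.eq hw
  rw [← heq, ae_iff, hμA, Measure.smul_apply]
  have : (μ.restrict A) {a | ¬ a ∈ A} = 0 := by
    rw [← ae_iff]; exact ae_restrict_mem hA
  rw [this, smul_zero]

end Erg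

end HelpersE1

section HelpersG
open scoped Topology NNReal

theorem log_bound (α₁ α₂ β₁ β₂ c : ℝ) (hc : 0 ≤ c) :
    ENNReal.ofReal (Real.log (1 + max |α₁| |α₂| + max |β₁| |β₂| + c)) ≤
      ENNReal.ofReal (Real.log (3 + c)) + ENNReal.ofReal (Real.log (max |α₁| 1)) +
        ENNReal.ofReal (Real.log (max |α₂| 1)) + ENNReal.ofReal (Real.log (max |β₁| 1)) +
        ENNReal.ofReal (Real.log (max |β₂| 1)) := by
  set x₁ := max |α₁| 1 with hx₁
  set x₂ := max |α₂| 1 with hx₂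
  set y₁ := max |β₁| 1 with hy₁
  set y₂ := max |β₂| 1 with hy₂
  have h1 : 1 ≤ x₁ := le_max_right _ _
  have h2 : 1 ≤ x₂ := le_max_right _ _
  have h3 : 1 ≤ y₁ := le_max_right _ _
  have h4 : 1 ≤ y₂ := le_max_right _ _
  have a1 : |α₁| ≤ x₁ := le_max_left _ _
  have a2 : |α₂| ≤ x₂ := le_max_left _ _
  have a3 : |β₁| ≤ y₁ := le_max_left _ _
  have a4 : |β₂| ≤ y₂ := le_max_left _ _
  have hxx : 1 ≤ x₁ * x₂ := one_le_mul_of_one_le_of_one_le h1 h2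
  have hyy : 1 ≤ y₁ * y₂ := one_le_mul_of_one_le_of_one_le h3 h4
  have hx1' : x₁ ≤ x₁ * x₂ := le_mul_of_one_le_right (by linarith) h2
  have hx2' : x₂ ≤ x₁ * x₂ := le_mul_of_one_le_left (by linarith) h1
  have hy1' : y₁ ≤ y₁ * y₂ := le_mul_of_one_le_right (by linarith) h4
  have hy2' : y₂ ≤ y₁ * y₂ := le_mul_of_one_le_left (by linarith) h3
  have hl : max |α₁| |α₂| ≤ x₁ * x₂ := max_le (by linarith) (by linarith)
  have hb : max |β₁| |β₂| ≤ y₁ * y₂ := max_le (by linarith) (by linarith)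
  have hM1 : x₁ * x₂ ≤ (x₁ * x₂) * (y₁ * y₂) := le_mul_of_one_le_right (by linarith) hyy
  have hM2 : y₁ * y₂ ≤ (x₁ * x₂) * (y₁ * y₂) := le_mul_of_one_le_left (by linarith) hxx
  set M := (x₁ * x₂) * (y₁ * y₂) with hM
  have hM0 : 1 ≤ M := hxx.trans hM1
  have hl0 : 0 ≤ max |α₁| |α₂| := (abs_nonneg _).trans (le_max_left _ _)
  have hb0 : 0 ≤ max |β₁| |β₂| := (abs_nonneg _).trans (le_max_left _ _)
  have hle : 1 + max |α₁| |α₂| + max |β₁| |β₂| + c ≤ (3 + c) * M := by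
    have : c ≤ c * M := le_mul_of_one_le_right hc hM0
    nlinarith
  have hlog := Real.log_le_log (by linarith) hle
  have he : Real.log ((3 + c) * M) = Real.log (3 + c) + Real.log x₁ + Real.log x₂ + Real.log y₁ +
      Real.log y₂ := by
    rw [hM, Real.log_mul (by linarith) (by linarith), Real.log_mul (by linarith) (by linarith),
      Real.log_mul (by linarith) (by linarith), Real.log_mul (by linarith) (by linarith)]
    ring
  rw [he] at hlog
  refine (ENNReal.ofReal_le_ofReal hlog).trans ?_
  refine ENNReal.ofReal_add_le.trans (add_le_add ?_ le_rfl)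
  refine ENNReal.ofReal_add_le.trans (add_le_add ?_ le_rfl)
  refine ENNReal.ofReal_add_le.trans (add_le_add ?_ le_rfl)
  exact ENNReal.ofReal_add_le

theorem thresholdMap_abs_le {d : ℕ} (a₁ a₂ b₁ b₂ r : (Fin d → ℝ) → ℝ) (x : Fin d → ℝ) (y : ℝ) :
    |thresholdMap a₁ a₂ b₁ b₂ r x y| ≤ max |a₁ x| |a₂ x| * |y| + max |b₁ x| |b₂ x| := by
  unfold thresholdMap
  have hy := abs_nonneg y
  split_ifs
  · refine (abs_add_le _ _).trans ?_
    rw [abs_mul, add_comm]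
    exact add_le_add (mul_le_mul_of_nonneg_right (le_max_left _ _) hy) (le_max_left _ _)
  · refine (abs_add_le _ _).trans ?_
    rw [abs_mul, add_comm]
    exact add_le_add (mul_le_mul_of_nonneg_right (le_max_right _ _) hy) (le_max_right _ _)

end HelpersG

theorem threshold_AR_stationary_ergodic_solution
    {d : ℕ}
    {Ω : Type*} [MeasurableSpace Ω] (Pr : Measure Ω) [IsProbabilityMeasure Pr]
    (X : ℤ → Ω → (Fin d → ℝ)) (hX : ∀ t, Measurable (X t))
    -- the environment is stationary and ergodic
    (hstat : (Pr.map fun ω => fun t => X t ω).map zshift = Pr.map fun ω => fun t => X t ω)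
    (herg : Ergodic zshift (Pr.map fun ω => fun t => X t ω))
    -- the coefficient functions
    (a₁ a₂ b₁ b₂ r : (Fin d → ℝ) → ℝ)
    (ha₁ : Measurable a₁) (ha₂ : Measurable a₂) (hb₁ : Measurable b₁) (hb₂ : Measurable b₂)
    (hr : Measurable r)
    -- the noise density: positive, lower-bounded on compact sets, integrable with finite mean
    (f : ℝ → ℝ) (hf : Measurable f) (hfpos : ∀ u, 0 < f u)
    (hfdens : ∫⁻ u, ENNReal.ofReal (f u) = 1)
    (hflow : ∀ R > (0 : ℝ), ∃ c > (0 : ℝ), ∀ u : ℝ, |u| ≤ R → c ≤ f u)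
    (hmoment : ∫⁻ u, ENNReal.ofReal (|u| * f u) < ∞)
    -- log⁺ moments of the coefficients
    (ha₁log : ∫⁻ ω, ENNReal.ofReal (Real.log (max |a₁ (X 0 ω)| 1)) ∂Pr < ∞)
    (ha₂log : ∫⁻ ω, ENNReal.ofReal (Real.log (max |a₂ (X 0 ω)| 1)) ∂Pr < ∞)
    (hb₁log : ∫⁻ ω, ENNReal.ofReal (Real.log (max |b₁ (X 0 ω)| 1)) ∂Pr < ∞)
    (hb₂log : ∫⁻ ω, ENNReal.ofReal (Real.log (max |b₂ (X 0 ω)| 1)) ∂Pr < ∞)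
    -- 𝔼 log λ(X₀) < 0 with λ(x) = max(|a₁(x)|, |a₂(x)|), allowing the value -∞
    (hneg : ∫⁻ ω, ENNReal.ofReal (Real.log (max |a₁ (X 0 ω)| |a₂ (X 0 ω)|)) ∂Pr <
      ∫⁻ ω, ENNReal.ofReal (-Real.log (max |a₁ (X 0 ω)| |a₂ (X 0 ω)|)) ∂Pr)
    -- the transition kernel of the model: P_x(y, A) = ∫_A f(y' − s(x,y)) dy'
    (P : Kernel ((Fin d → ℝ) × ℝ) ℝ) [IsMarkovKernel P]
    (hP : ∀ (x : Fin d → ℝ) (y : ℝ) (A : Set ℝ), MeasurableSet A →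
      P (x, y) A = ∫⁻ u in A, ENNReal.ofReal (f (u - thresholdMap a₁ a₂ b₁ b₂ r x y))) :
    -- there is a unique stationary solution, and it is ergodic
    ∃ μ : Measure (ℤ → ℝ × (Fin d → ℝ)),
      (IsProbabilityMeasure μ ∧ μ.map zshift = μ ∧
        μ.map (fun z => fun t => (z t).2) = Pr.map (fun ω => fun t => X t ω) ∧
        IsMCRESolution P μ ∧ Ergodic zshift μ) ∧
      ∀ μ' : Measure (ℤ → ℝ × (Fin d → ℝ)),
        IsProbabilityMeasure μ' → μ'.map zshift = μ' →
        μ'.map (fun z => fun t => (z t).2) = Pr.map (fun ω => fun t => X t ω) →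
        IsMCRESolution P μ' → μ' = μ := by
  have hXm : Measurable fun ω => fun t => X t ω := measurable_pi_lambda _ hX
  set π := Pr.map fun ω => fun t => X t ω with hπ
  have hπp : IsProbabilityMeasure π := Measure.isProbabilityMeasure_map hXm.aemeasurable
  have hfm : Measurable fun u => ENNReal.ofReal (f u) := hf.ennreal_ofReal
  obtain ⟨ν, hνf⟩ : ∃ ν : Measure ℝ, ν = volume.withDensity fun u => ENNReal.ofReal (f u) :=
    ⟨_, rfl⟩
  have hνp : IsProbabilityMeasure ν := by
    constructor
    rw [hνf, withDensity_apply _ MeasurableSet.univ, Measure.restrict_univ, hfdens]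
  have hνi : Integrable (fun u : ℝ => |u|) ν := by
    refine ⟨continuous_abs.aestronglyMeasurable, ?_⟩
    rw [HasFiniteIntegral, hνf, lintegral_withDensity_eq_lintegral_mul _ hfm
      (g := fun u : ℝ => ‖|u|‖ₑ) (by fun_prop)]
    refine lt_of_le_of_lt (le_of_eq ?_) hmoment
    refine lintegral_congr fun u => ?_
    rw [Pi.mul_apply, Real.enorm_of_nonneg (abs_nonneg u), ENNReal.ofReal_mul (abs_nonneg u),
      mul_comm]
  set s : (Fin d → ℝ) × ℝ → ℝ := fun q => thresholdMap a₁ a₂ b₁ b₂ r q.1 q.2 with hs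
  have hPν : ∀ q, P q = ν.map fun u => s q + u := by
    rintro ⟨x, y⟩
    ext A hA
    rw [hP x y A hA, Measure.map_apply (measurable_const_add _) hA, hνf,
      withDensity_apply _ (measurable_const_add _ hA), ← lintegral_indicator hA,
      ← lintegral_indicator (measurable_const_add _ hA),
      ← lintegral_add_left_eq_self _ (s (x, y))]
    refine lintegral_congr fun u => ?_
    by_cases hu : s (x, y) + u ∈ A
    · rw [Set.indicator_of_mem hu, Set.indicator_of_mem (show u ∈ _ ⁻¹' A from hu)]
      simp [hs]
    · rw [Set.indicator_of_notMem hu, Set.indicator_of_notMem (show u ∉ _ ⁻¹' A from hu)]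
  have hPpos : ∀ q A, MeasurableSet A → (P q A = 0 ↔ (volume : Measure ℝ) A = 0) := by
    rintro ⟨x, y⟩ A hA
    rw [hP x y A hA]
    have hgm : Measurable fun u => ENNReal.ofReal (f (u - thresholdMap a₁ a₂ b₁ b₂ r x y)) :=
      hfm.comp (measurable_id.sub_const _)
    have h1 := setLIntegral_pos_iff (μ := (volume : Measure ℝ)) (s := A) hgm
    have h2 : (Function.support fun u => ENNReal.ofReal (f (u - thresholdMap a₁ a₂ b₁ b₂ r x y))) =
        Set.univ := by
      ext u; simp [hfpos]
    rw [h2, Set.univ_inter, pos_iff_ne_zero, pos_iff_ne_zero] at h1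
    exact not_iff_not.1 h1
  have hlm : Measurable fun x => max |a₁ x| |a₂ x| := by fun_prop
  have hBm : Measurable fun x => max |b₁ x| |b₂ x| := by fun_prop
  set c := ∫ u, |u| ∂ν with hc
  have hc0 : 0 ≤ c := integral_nonneg fun u => abs_nonneg u
  have htr : ∀ g : (Fin d → ℝ) → ℝ, Measurable g →
      ∫⁻ x, ENNReal.ofReal (g (x 0)) ∂π = ∫⁻ ω, ENNReal.ofReal (g (X 0 ω)) ∂Pr := by
    intro g hg
    rw [hπ, lintegral_map (f := fun x : ℤ → Fin d → ℝ => ENNReal.ofReal (g (x 0)))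
      ((hg.comp (measurable_pi_apply 0)).ennreal_ofReal) hXm]
  have hG : ∫⁻ x, ENNReal.ofReal (Real.log (1 + max |a₁ (x 0)| |a₂ (x 0)| +
      max |b₁ (x 0)| |b₂ (x 0)| + c)) ∂π < ∞ := by
    rw [htr (fun v => Real.log (1 + max |a₁ v| |a₂ v| + max |b₁ v| |b₂ v| + c)) (by fun_prop)]
    refine lt_of_le_of_lt (lintegral_mono fun ω => log_bound _ _ _ _ c hc0) ?_
    have hX0 := hX 0
    rw [lintegral_add_right _ (by fun_prop), lintegral_add_right _ (by fun_prop),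
      lintegral_add_right _ (by fun_prop), lintegral_add_right _ (by fun_prop), lintegral_const,
      measure_univ, mul_one]
    exact ENNReal.add_lt_top.2 ⟨ENNReal.add_lt_top.2 ⟨ENNReal.add_lt_top.2 ⟨ENNReal.add_lt_top.2
      ⟨ENNReal.ofReal_lt_top, ha₁log⟩, ha₂log⟩, hb₁log⟩, hb₂log⟩
  obtain ⟨m, hmp, hminv, hmfst⟩ := exists_invariant_measure π herg P f hf ν hνf s hPν
    (fun x => max |a₁ x| |a₂ x|) (fun x => max |b₁ x| |b₂ x|) hlm hBm
    (fun x => (abs_nonneg _).trans (le_max_left _ _))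
    (fun x => (abs_nonneg _).trans (le_max_left _ _))
    (fun x y => thresholdMap_abs_le a₁ a₂ b₁ b₂ r x y) hνi hG
    (by
      rw [htr (fun v => Real.log (max |a₁ v| |a₂ v|)) (by fun_prop),
        htr (fun v => -Real.log (max |a₁ v| |a₂ v|)) (by fun_prop)]
      exact hneg)
  obtain ⟨μ, hμp, hw⟩ := exists_hasWin P m hminv
  refine ⟨μ, ⟨hμp, hw.shift, by rw [hw.env, hmfst], (isMCRESolution_iff P μ).2 hw.sol.solRect,
    ergodic_of_unique P hPpos m hminv (by rw [hmfst]; exact herg) hw⟩, ?_⟩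
  intro μ' hμ'p hst hX' hsol
  have hw' : HasWin P m μ' := (((isMCRESolution_iff P μ').1 hsol).solLaw).hasWin_of_stat hPpos hminv
    hst (by rw [hX', hmfst])
  exact hw'.eq hw

end
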